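/- Let ξ ∈ h*/ℤR have zero central charge, let λ ∈ ξ and i, j ∈ ℤ≥0. Then the multiplicity of Δ(λ - j h✓) in a Verma flag of the indecomposable projective cover P^{(λ)}(λ - i h✓) of L(λ - i h✓) in O[ξ,λ] equals the composition multiplicity of L(λ - i h✓) in Δ(λ - j h✓) (BGG reciprocity). -/

import Mathlib

set_option maxSynthPendingDepth 3

namespace Schrodinger

noncomputable section

open scoped TensorProduct

/-- Generators of the Schrödinger algebra. -/
inductive Gen : Type
  | E | H | F | P | Q | Z
  deriving DecidableEq

/-- The free algebra on the generators. -/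
abbrev FA : Type := FreeAlgebra ℂ Gen

/-- Inclusion of generators. -/
def ιg (g : Gen) : FA := FreeAlgebra.ι ℂ g

/-- The defining relations of the universal enveloping algebra of the Schrödinger
algebra `s`: `z` is central and `[h,e]=2e`, `[e,f]=h`, `[h,f]=-2f`, `[e,q]=p`,
`[e,p]=0`, `[h,p]=p`, `[f,p]=q`, `[f,q]=0`, `[h,q]=-q`, `[p,q]=z`. -/
inductive Rel : FA → FA → Prop
  | he : Rel (ιg .H * ιg .E) (ιg .E * ιg .H + 2 * ιg .E)
  | ef : Rel (ιg .E * ιg .F) (ιg .F * ιg .E + ιg .H)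
  | hf : Rel (ιg .H * ιg .F) (ιg .F * ιg .H - 2 * ιg .F)
  | eq : Rel (ιg .E * ιg .Q) (ιg .Q * ιg .E + ιg .P)
  | ep : Rel (ιg .E * ιg .P) (ιg .P * ιg .E)
  | hp : Rel (ιg .H * ιg .P) (ιg .P * ιg .H + ιg .P)
  | fp : Rel (ιg .F * ιg .P) (ιg .P * ιg .F + ιg .Q)
  | fq : Rel (ιg .F * ιg .Q) (ιg .Q * ιg .F)
  | hq : Rel (ιg .H * ιg .Q) (ιg .Q * ιg .H - ιg .Q)
  | pq : Rel (ιg .P * ιg .Q) (ιg .Q * ιg .P + ιg .Z)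
  | ze : Rel (ιg .Z * ιg .E) (ιg .E * ιg .Z)
  | zh : Rel (ιg .Z * ιg .H) (ιg .H * ιg .Z)
  | zf : Rel (ιg .Z * ιg .F) (ιg .F * ιg .Z)
  | zp : Rel (ιg .Z * ιg .P) (ιg .P * ιg .Z)
  | zq : Rel (ιg .Z * ιg .Q) (ιg .Q * ιg .Z)

/-- The universal enveloping algebra `U = U(s)` of the Schrödinger algebra,
presented by generators and relations (via the PBW theorem). -/
abbrev U : Type := RingQuot Rel

/-- The generators of `U`. -/
def gen (g : Gen) : U := RingQuot.mkAlgHom ℂ Rel (ιg g)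

def E : U := gen .E
def H : U := gen .H
def F : U := gen .F
def P : U := gen .P
def Q : U := gen .Q
def Z : U := gen .Z

/-- Scalars inside `U`. -/
def sc (a : ℂ) : U := algebraMap ℂ U a

/-- The Casimir element `c = (h² + h + 4fe)z − 2(fp² − eq² − hpq)`. -/
def cElt : U := (H * H + H + 4 * (F * E)) * Z - 2 * (F * (P * P) - E * (Q * Q) - H * (P * Q))

/-- The left ideal of `U` defining the Verma module `Δ(λ)` for
`λ ∈ 𝔥*` with `λ(h) = hh`, `λ(z) = zz`:  it is generated by `n₊ = span{e,p}`
together with `h - λ(h)` and `z - λ(z)`; then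
`Δ(λ) = U ⊗_{U(𝔟)} ℂ_λ ≅ U / U(e, p, h - λ(h), z - λ(z))`. -/
def vermaIdeal (hh zz : ℂ) : Submodule U U :=
  Submodule.span U ({E, P, H - sc hh, Z - sc zz} : Set U)

/-- The Verma module `Δ(λ)` with highest weight `λ`, `λ(h) = hh`, `λ(z) = zz`. -/
abbrev Verma (hh zz : ℂ) : Type := U ⧸ vermaIdeal hh zz

/-- The canonical highest weight generator `v_λ` of `Δ(λ)`. -/
def hwVec (hh zz : ℂ) : Verma hh zz := Submodule.Quotient.mk 1

/-- The unique maximal submodule `K(λ)` of `Δ(λ)`. -/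
def vermaRad (hh zz : ℂ) : Submodule U (Verma hh zz) := sSup {N : Submodule U (Verma hh zz) | N ≠ ⊤}

/-- The simple highest weight module `L(λ) = Δ(λ)/K(λ)`. -/
abbrev SimpleHW (hh zz : ℂ) : Type := Verma hh zz ⧸ vermaRad hh zz

/-- The scalar `ϑ_λ = (λ(h)² + 3λ(h) + 2)·λ(z)` by which the Casimir element `c`
acts on the Verma module `Δ(λ)`. -/
def vartheta (hh zz : ℂ) : ℂ := (hh ^ 2 + 3 * hh + 2) * zz

end

end Schrodinger

namespace Schrodinger

noncomputable section

open CategoryTheory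

/-- The `ℂ`-vector space structure on a `U`-module, obtained by restricting
scalars along `ℂ → U`. -/
def cmod (M : Type) [AddCommGroup M] [Module U M] : Module ℂ M :=
  Module.compHom M (algebraMap ℂ U)

/-- `v` is a weight vector of weight `λ` with `λ(h) = hh` and `λ(z) = zz`. -/
def IsWeightVec {M : Type} [AddCommGroup M] [Module U M] (hh zz : ℂ) (v : M) : Prop :=
  H • v = sc hh • v ∧ Z • v = sc zz • v

/-- The subalgebra `U(n₊)` of `U` generated by `n₊ = span{e, p}`. -/
def nPlus : Subalgebra ℂ U := Algebra.adjoin ℂ ({E, P} : Set U)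

/-- Membership in category `O`: finitely generated, a (direct) sum of its
weight spaces, and locally `U(n₊)`-finite. -/
def InO (M : Type) [AddCommGroup M] [Module U M] : Prop :=
  Module.Finite U M ∧
  (∀ v : M, v ∈ AddSubgroup.closure {w : M | ∃ hh zz : ℂ, IsWeightVec hh zz w}) ∧
  (letI := cmod M
   ∀ v : M, ∃ W : Submodule ℂ M, FiniteDimensional ℂ W ∧ ∀ u ∈ nPlus, u • v ∈ W)

/-- Membership in the block `O[ξ]`, where `ξ ∈ 𝔥*/ℤR` is the class of the weight
`(hh0, zz0)` (so that the weights in `ξ` are exactly `(hh0 + n, zz0)`, `n ∈ ℤ`):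
the module is in `O` and all its weights lie in `ξ`. -/
def InBlock (hh0 zz0 : ℂ) (M : ModuleCat.{0} U) : Prop :=
  InO M ∧
  ∀ (v : M) (hh zz : ℂ), v ≠ 0 → IsWeightVec hh zz v → zz = zz0 ∧ ∃ n : ℤ, hh = hh0 + n

/-- The Verma module as an object of the category of `U`-modules. -/
def VermaC (hh zz : ℂ) : ModuleCat.{0} U := ModuleCat.of U (Verma hh zz)

/-- `Pc` is a Serre class inside the subcategory (of the category of `U`-modules)
cut out by `Oc`: it is contained in `Oc`, closed under isomorphism, and for every
short exact sequence `0 → N → M → M/N → 0` in `Oc`, `M` belongs to `Pc` if and only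
if both `N` and `M/N` do. -/
def SerreClassIn (Oc Pc : ModuleCat.{0} U → Prop) : Prop :=
  (∀ M, Pc M → Oc M) ∧
  (∀ M N : ModuleCat.{0} U, Nonempty ((M : Type) ≃ₗ[U] (N : Type)) → Pc M → Oc N → Pc N) ∧
  (∀ (M : ModuleCat.{0} U) (N : Submodule U M), Oc M →
      (Pc M ↔ Pc (ModuleCat.of U N) ∧ Pc (ModuleCat.of U ((M : Type) ⧸ N))))

/-- Membership in the Serre subcategory of the subcategory cut out by `Oc`
generated by the set of objects `S`. -/
def InSerreGen (Oc : ModuleCat.{0} U → Prop) (S : Set (ModuleCat.{0} U))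
    (M : ModuleCat.{0} U) : Prop :=
  Oc M ∧ ∀ Pc : ModuleCat.{0} U → Prop, SerreClassIn Oc Pc → (∀ X ∈ S, Pc X) → Pc M

end

end Schrodinger

namespace Schrodinger

open CategoryTheory

noncomputable section

/-- Membership in the truncated category `O[ξ, λ]`, where `ξ` is the (zero
central charge) block of the weight `λ` with `λ(h) = hh0`, `λ(z) = 0`. -/
def InTrunc (hh0 : ℂ) (M : ModuleCat.{0} U) : Prop :=
  InBlock hh0 0 M ∧
  ∀ (v : M) (i : ℕ), 1 ≤ i → IsWeightVec (hh0 + i) 0 v → v = 0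

/-- `Pm` is a projective object of the truncated category `O[ξ, λ]`. -/
def ProjInTrunc (hh0 : ℂ) (Pm : ModuleCat.{0} U) : Prop :=
  ∀ M N : ModuleCat.{0} U, InTrunc hh0 M → InTrunc hh0 N →
    ∀ g : (M : Type) →ₗ[U] N, Function.Surjective g →
      ∀ f : (Pm : Type) →ₗ[U] N, ∃ f' : (Pm : Type) →ₗ[U] M, g ∘ₗ f' = f

/-- `Pm` is an indecomposable module. -/
def Indec (Pm : ModuleCat.{0} U) : Prop :=
  Nontrivial Pm ∧
  ¬ ∃ N₁ N₂ : Submodule U Pm, IsCompl N₁ N₂ ∧ N₁ ≠ ⊥ ∧ N₂ ≠ ⊥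

/-- The subquotient `B/A` associated to submodules `A ≤ B` of a module. -/
def subQuot {M : Type} [AddCommGroup M] [Module U M] (A B : Submodule U M) : Type :=
  B ⧸ Submodule.comap B.subtype A

noncomputable instance {M : Type} [AddCommGroup M] [Module U M] (A B : Submodule U M) :
    AddCommGroup (subQuot A B) := by unfold subQuot; infer_instance

noncomputable instance {M : Type} [AddCommGroup M] [Module U M] (A B : Submodule U M) :
    Module U (subQuot A B) := by unfold subQuot; infer_instance

/-- A Verma flag of the module `M` relative to the weight `λ` (with
`λ(h) = hh0`, zero central charge): a finite filtration
`0 = Fl 0 ≤ Fl 1 ≤ … ≤ Fl n = M` whose subquotients are Verma modules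
`Δ(λ - j·h✓)`, `j ∈ ℤ≥0`. -/
def IsVermaFlag (hh0 : ℂ) {M : ModuleCat.{0} U} (n : ℕ)
    (Fl : Fin (n + 1) → Submodule U (M : Type)) : Prop :=
  Monotone Fl ∧ Fl 0 = ⊥ ∧ Fl (Fin.last n) = ⊤ ∧
  ∀ k : Fin n, ∃ j : ℕ,
    Nonempty (subQuot (Fl k.castSucc) (Fl k.succ) ≃ₗ[U] Verma (hh0 - j) 0)

/-- The number of subquotients of the flag `Fl` isomorphic to `Δ(λ - j·h✓)`,
i.e. the multiplicity `[M : Δ(λ - j·h✓)]` of this Verma module in the flag. -/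
noncomputable def vermaFlagCount (hh0 : ℂ) {M : ModuleCat.{0} U} (n : ℕ)
    (Fl : Fin (n + 1) → Submodule U (M : Type)) (j : ℕ) : ℕ :=
  Nat.card {k : Fin n //
    Nonempty (subQuot (Fl k.castSucc) (Fl k.succ) ≃ₗ[U] Verma (hh0 - j) 0)}

/-- The module `M` has (at least) `n` stacked layers isomorphic to `L`: there
are chains of submodules `A 1 ≤ B 1 ≤ A 2 ≤ B 2 ≤ … ≤ A n ≤ B n` with each
`B k / A k ≅ L`. -/
def HasLayers (M : Type) [AddCommGroup M] [Module U M]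
    (L : Type) [AddCommGroup L] [Module U L] (n : ℕ) : Prop :=
  ∃ A B : Fin n → Submodule U M,
    (∀ k, A k ≤ B k) ∧ (∀ k l : Fin n, k < l → B k ≤ A l) ∧
    ∀ k, Nonempty (subQuot (A k) (B k) ≃ₗ[U] L)

/-- The composition multiplicity `(M : L)` of `L` in `M`, defined as the
supremum (in `ℕ∞`) of the numbers of stacked subquotient layers of `M`
isomorphic to `L`. -/
noncomputable def compMult (M : Type) [AddCommGroup M] [Module U M]
    (L : Type) [AddCommGroup L] [Module U L] : ℕ∞ :=
  sSup {c : ℕ∞ | ∃ n : ℕ, HasLayers M L n ∧ c = (n : ℕ∞)}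

theorem mkAlgHom_rel {x y : FA} (h : Rel x y) :
    RingQuot.mkAlgHom ℂ Rel x = RingQuot.mkAlgHom ℂ Rel y :=
  RingQuot.mkAlgHom_rel ℂ h

theorem H_mul_E : H * E = E * H + 2 * E := by
  simpa [gen, H, E, two_mul] using mkAlgHom_rel Rel.he
theorem E_mul_F : E * F = F * E + H := by
  simpa [gen, H, E, F] using mkAlgHom_rel Rel.ef
theorem H_mul_F : H * F = F * H - 2 * F := by
  simpa [gen, H, F, two_mul] using mkAlgHom_rel Rel.hf
theorem E_mul_Q : E * Q = Q * E + P := by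
  simpa [gen, E, P, Q] using mkAlgHom_rel Rel.eq
theorem E_mul_P : E * P = P * E := by
  simpa [gen, E, P] using mkAlgHom_rel Rel.ep
theorem H_mul_P : H * P = P * H + P := by
  simpa [gen, H, P] using mkAlgHom_rel Rel.hp
theorem F_mul_P : F * P = P * F + Q := by
  simpa [gen, F, P, Q] using mkAlgHom_rel Rel.fp
theorem F_mul_Q : F * Q = Q * F := by
  simpa [gen, F, Q] using mkAlgHom_rel Rel.fq
theorem H_mul_Q : H * Q = Q * H - Q := by
  simpa [gen, H, Q] using mkAlgHom_rel Rel.hq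
theorem P_mul_Q : P * Q = Q * P + Z := by
  simpa [gen, P, Q, Z] using mkAlgHom_rel Rel.pq
theorem Z_mul_E : Z * E = E * Z := by
  simpa [gen, Z, E] using mkAlgHom_rel Rel.ze
theorem Z_mul_H : Z * H = H * Z := by
  simpa [gen, Z, H] using mkAlgHom_rel Rel.zh
theorem Z_mul_F : Z * F = F * Z := by
  simpa [gen, Z, F] using mkAlgHom_rel Rel.zf
theorem Z_mul_P : Z * P = P * Z := by
  simpa [gen, Z, P] using mkAlgHom_rel Rel.zp
theorem Z_mul_Q : Z * Q = Q * Z := by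
  simpa [gen, Z, Q] using mkAlgHom_rel Rel.zq

/-- A subalgebra of `U` containing the generators is everything. -/
theorem mem_of_gen_mem (S : Subalgebra ℂ U) (hS : ∀ g, gen g ∈ S) (u : U) : u ∈ S := by
  obtain ⟨x, rfl⟩ := RingQuot.mkAlgHom_surjective ℂ Rel u
  induction x using FreeAlgebra.induction with
  | grade0 r => rw [AlgHom.commutes]; exact S.algebraMap_mem r
  | grade1 g => exact hS g
  | mul a b ha hb => rw [map_mul]; exact S.mul_mem ha hb
  | add a b ha hb => rw [map_add]; exact S.add_mem ha hb

/-- The algebra homomorphism out of `U` given by images of the generators. -/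
def uLift {A : Type} [Ring A] [Algebra ℂ A] (φ : Gen → A)
    (h : ∀ ⦃x y⦄, Rel x y → FreeAlgebra.lift ℂ φ x = FreeAlgebra.lift ℂ φ y) : U →ₐ[ℂ] A :=
  RingQuot.liftAlgHom ℂ ⟨FreeAlgebra.lift ℂ φ, h⟩

theorem uLift_gen {A : Type} [Ring A] [Algebra ℂ A] (φ : Gen → A)
    (h : ∀ ⦃x y⦄, Rel x y → FreeAlgebra.lift ℂ φ x = FreeAlgebra.lift ℂ φ y) (g : Gen) :
    uLift φ h (gen g) = φ g := by
  simp [uLift, gen, ιg]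

/-- Images of the generators under the anti-involution of `U`. -/
def antiGen : Gen → Uᵐᵒᵖ
  | .E => .op (-F)
  | .F => .op (-E)
  | .H => .op H
  | .P => .op Q
  | .Q => .op P
  | .Z => .op Z

theorem antiGen_rel ⦃x y : FA⦄ (h : Rel x y) :
    FreeAlgebra.lift ℂ antiGen x = FreeAlgebra.lift ℂ antiGen y := by
  have two (a : U) : a * 2 = 2 * a := by rw [mul_two, two_mul]
  apply MulOpposite.unop_injective
  cases h <;> simp only [ιg, map_mul, map_add, map_sub, map_ofNat, FreeAlgebra.lift_ι_apply, antiGen,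
    MulOpposite.unop_mul, MulOpposite.unop_add, MulOpposite.unop_sub, MulOpposite.unop_op,
    MulOpposite.unop_ofNat, mul_neg, neg_mul, neg_neg, H_mul_E, E_mul_F, H_mul_F, E_mul_Q, E_mul_P,
    H_mul_P, F_mul_P, F_mul_Q, H_mul_Q, P_mul_Q, Z_mul_E, Z_mul_H, Z_mul_F, Z_mul_P, Z_mul_Q, two] <;>
    abel

/-- The anti-involution `e ↦ -f`, `f ↦ -e`, `h ↦ h`, `p ↦ q`, `q ↦ p`, `z ↦ z` of `U`. -/
def anti : U →ₗ[ℂ] U :=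
  (MulOpposite.opLinearEquiv ℂ).symm.toLinearMap ∘ₗ (uLift antiGen antiGen_rel).toLinearMap

theorem anti_gen (g : Gen) : anti (gen g) = (antiGen g).unop := by
  simp [anti, uLift_gen]

@[simp] theorem anti_E : anti E = -F := anti_gen .E
@[simp] theorem anti_F : anti F = -E := anti_gen .F
@[simp] theorem anti_H : anti H = H := anti_gen .H
@[simp] theorem anti_P : anti P = Q := anti_gen .P
@[simp] theorem anti_Q : anti Q = P := anti_gen .Q
@[simp] theorem anti_Z : anti Z = Z := anti_gen .Z
@[simp] theorem anti_one : anti 1 = 1 := by simp [anti]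
@[simp] theorem anti_mul (a b : U) : anti (a * b) = anti b * anti a := by simp [anti]

@[simp] theorem anti_anti (u : U) : anti (anti u) = u := by
  refine mem_of_gen_mem
    { carrier := {u | anti (anti u) = u}
      mul_mem' := fun {a b} ha hb => ?_
      add_mem' := fun {a b} ha hb => ?_
      algebraMap_mem' := fun r => ?_ } ?_ u
  · simp only [Set.mem_ofPred_eq] at *; simp [ha, hb]
  · simp only [Set.mem_ofPred_eq] at *; simp [ha, hb]
  · simp [Algebra.algebraMap_eq_smul_one]
  · rintro (_ | _ | _ | _ | _ | _)
    · change anti (anti E) = E; simp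
    · change anti (anti H) = H; simp
    · change anti (anti F) = F; simp
    · change anti (anti P) = P; simp
    · change anti (anti Q) = Q; simp
    · change anti (anti Z) = Z; simp

theorem Z_mul (u : U) : Z * u = u * Z := by
  refine mem_of_gen_mem (Subalgebra.centralizer ℂ {Z}) ?_ u |> fun h => h Z rfl
  intro g
  rw [Subalgebra.mem_centralizer_iff]
  rintro _ rfl
  rcases g with _ | _ | _ | _ | _ | _
  exacts [Z_mul_E, Z_mul_H, Z_mul_F, Z_mul_P, Z_mul_Q, rfl]

/-- The degree `n` part of `U` with respect to the adjoint action of `h`. -/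
def gr (n : ℤ) : Submodule ℂ U where
  carrier := {u | H * u = u * H + (n : ℂ) • u}
  add_mem' {a b} ha hb := by
    simp only [Set.mem_ofPred_eq] at *
    rw [mul_add, ha, hb, add_mul, smul_add]; abel
  zero_mem' := by simp
  smul_mem' c a ha := by
    simp only [Set.mem_ofPred_eq] at *
    rw [mul_smul_comm, ha, smul_add, smul_mul_assoc, smul_comm]

theorem mem_gr {n : ℤ} {u : U} : u ∈ gr n ↔ H * u = u * H + (n : ℂ) • u := Iff.rfl

theorem mul_mem_gr {m n : ℤ} {a b : U} (ha : a ∈ gr m) (hb : b ∈ gr n) : a * b ∈ gr (m + n) := by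
  rw [mem_gr] at *
  rw [← mul_assoc, ha, add_mul, mul_assoc, hb, mul_add, smul_mul_assoc, mul_smul_comm,
    ← mul_assoc, Int.cast_add, add_smul]
  abel

theorem E_mem_gr : E ∈ gr 2 := by
  rw [mem_gr, H_mul_E]; simp [two_mul, two_smul]
theorem P_mem_gr : P ∈ gr 1 := by
  rw [mem_gr, H_mul_P]; simp
theorem F_mem_gr : F ∈ gr (-2) := by
  rw [mem_gr, H_mul_F]; simp [two_mul, two_smul, sub_eq_add_neg]
theorem Q_mem_gr : Q ∈ gr (-1) := by
  rw [mem_gr, H_mul_Q]; simp [sub_eq_add_neg]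
theorem H_mem_gr : H ∈ gr 0 := by
  rw [mem_gr]; simp
theorem Z_mem_gr : Z ∈ gr 0 := by
  rw [mem_gr, Z_mul]; simp

theorem anti_mem_gr {n : ℤ} {u : U} (hu : u ∈ gr n) : anti u ∈ gr (-n) := by
  rw [mem_gr] at *
  have := congrArg anti hu
  simp only [map_add, map_smul, anti_mul, anti_H] at this
  rw [this]; simp

theorem mem_iSup_gr (u : U) : u ∈ ⨆ n, gr n := by
  have hle : (⨆ n, gr n) * (⨆ n, gr n) ≤ ⨆ n, gr n := by
    simp only [Submodule.iSup_mul, Submodule.mul_iSup, iSup_le_iff, Submodule.mul_le]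
    exact fun m n a ha b hb => Submodule.mem_iSup_of_mem _ (mul_mem_gr ha hb)
  refine mem_of_gen_mem (Submodule.toSubalgebra (⨆ n, gr n)
    (Submodule.mem_iSup_of_mem 0 (by simp [mem_gr]))
    fun a b ha hb => hle (Submodule.mul_mem_mul ha hb)) ?_ u
  rintro (_ | _ | _ | _ | _ | _)
  exacts [Submodule.mem_iSup_of_mem _ E_mem_gr, Submodule.mem_iSup_of_mem _ H_mem_gr,
    Submodule.mem_iSup_of_mem _ F_mem_gr, Submodule.mem_iSup_of_mem _ P_mem_gr,
    Submodule.mem_iSup_of_mem _ Q_mem_gr, Submodule.mem_iSup_of_mem _ Z_mem_gr]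

section Weights

variable {M : Type} [AddCommGroup M] [Module U M] [Module ℂ M] [IsScalarTower ℂ U M]
variable {N : Type} [AddCommGroup N] [Module U N] [Module ℂ N] [IsScalarTower ℂ U N]

theorem sc_smul (c : ℂ) (v : M) : sc c • v = c • v := algebraMap_smul U c v

/-- The action of an element of `U` as a linear endomorphism. -/
def act (M : Type) [AddCommGroup M] [Module U M] [Module ℂ M] [IsScalarTower ℂ U M] (u : U) :
    Module.End ℂ M := Algebra.lsmul ℂ ℂ M u

@[simp] theorem act_apply (u : U) (v : M) : act M u v = u • v := rfl

/-- The `h`-eigenspace of a `U`-module. -/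
def eig (M : Type) [AddCommGroup M] [Module U M] [Module ℂ M] [IsScalarTower ℂ U M] (c : ℂ) :
    Submodule ℂ M := (act M H).eigenspace c

theorem mem_eig {c : ℂ} {v : M} : v ∈ eig M c ↔ H • v = c • v := Module.End.mem_eigenspace_iff

theorem gr_smul_mem {n : ℤ} {u : U} (hu : u ∈ gr n) {c : ℂ} {v : M} (hv : v ∈ eig M c) :
    u • v ∈ eig M (c + n) := by
  rw [mem_eig] at *
  rw [← mul_smul, mem_gr.1 hu, add_smul, mul_smul, hv, add_smul, smul_comm, smul_assoc]

theorem map_mem_eig (f : M →ₗ[U] N) {c : ℂ} {v : M} (hv : v ∈ eig M c) : f v ∈ eig N c := by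
  rw [mem_eig] at *
  rw [← map_smul, hv]
  exact f.map_smul_of_tower c v

theorem of_map_mem_eig (f : M →ₗ[U] N) (hf : Function.Injective f) {c : ℂ} {v : M}
    (hv : f v ∈ eig N c) : v ∈ eig M c := by
  rw [mem_eig] at *
  apply hf
  rw [map_smul, hv]
  exact (f.map_smul_of_tower c v).symm

theorem eq_of_sub_mem_iSup_eig {c : ℂ} {y z : M} (hy : y ∈ eig M c) (hz : z ∈ eig M c)
    (h : y - z ∈ ⨆ (d : ℂ) (_ : d ≠ c), eig M d) : y = z := by
  have := (Module.End.eigenspaces_iSupIndep (act M H) c).le_bot ⟨sub_mem hy hz, h⟩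
  exact sub_eq_zero.1 this

/-- If a space is spanned by subspaces mapped to distinct `h`-eigenspaces, then every eigenvector in
the image is the image of an element of the corresponding subspace. -/
theorem exists_mem_of_map_mem_eig {V ι : Type} [AddCommGroup V] [Module ℂ V]
    (f : V →ₗ[ℂ] M) (S : ι → Submodule ℂ V) (c : ι → ℂ) (hc : Function.Injective c)
    (hS : ∀ i, ∀ x ∈ S i, f x ∈ eig M (c i)) {x : V} (hx : x ∈ ⨆ i, S i) {i : ι}
    (hi : f x ∈ eig M (c i)) : ∃ y ∈ S i, f y = f x := by
  rw [iSup_split_single S i] at hx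
  obtain ⟨y, hy, z, hz, rfl⟩ := Submodule.mem_sup.1 hx
  refine ⟨y, hy, (eq_of_sub_mem_iSup_eig hi (hS i y hy) ?_).symm⟩
  rw [map_add, add_sub_cancel_left]
  have : (⨆ (j : ι) (_ : j ≠ i), S j) ≤ (⨆ (d : ℂ) (_ : d ≠ c i), eig M d).comap f := by
    refine iSup₂_le fun j hj w hw => ?_
    exact Submodule.mem_iSup_of_mem (c j) (Submodule.mem_iSup_of_mem (hc.ne hj) (hS j w hw))
  exact this hz

theorem exists_gr_smul_eq {a b : ℂ} {n : ℤ} (hn : b = a + n) {w : M} (hw : w ∈ eig M a) {u : U}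
    (hu : u • w ∈ eig M b) : ∃ u' ∈ gr n, u' • w = u • w := by
  refine exists_mem_of_map_mem_eig ((LinearMap.toSpanSingleton U M w).restrictScalars ℂ) gr
    (fun n => a + n) (fun m n h => by simpa using h) (fun n u hu => gr_smul_mem hu hw)
    (mem_iSup_gr u) (i := n) ?_
  rw [← hn]; exact hu

theorem exists_eig_lift (hM : ∀ v : M, v ∈ ⨆ c, eig M c) (f : M →ₗ[U] N)
    (hf : Function.Surjective f) {c : ℂ} {y : N} (hy : y ∈ eig N c) : ∃ x ∈ eig M c, f x = y := by
  obtain ⟨x, rfl⟩ := hf y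
  exact exists_mem_of_map_mem_eig (f.restrictScalars ℂ) (eig M) id Function.injective_id
    (fun c x hx => map_mem_eig f hx) (hM x) (i := c) hy

/-- `M` is a weight module with zero central charge and weights in `λ - ℕ`. -/
structure TW (a : ℂ) (M : Type) [AddCommGroup M] [Module U M] [Module ℂ M] [IsScalarTower ℂ U M] :
    Prop where
  zero : ∀ v : M, Z • v = 0
  top : ∀ v : M, v ∈ ⨆ c, eig M c
  wt : ∀ (c : ℂ) (v : M), v ∈ eig M c → v ≠ 0 → ∃ k : ℕ, c = a - k

/-- `M` has zero central charge and no weights in `λ + ℕ_{>0}`. -/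
structure TL (a : ℂ) (M : Type) [AddCommGroup M] [Module U M] [Module ℂ M] [IsScalarTower ℂ U M] :
    Prop where
  zero : ∀ v : M, Z • v = 0
  wt : ∀ (k : ℕ) (v : M), 1 ≤ k → v ∈ eig M (a + k) → v = 0

variable {a : ℂ}

theorem TW.tl (h : TW a M) : TL a M := by
  refine ⟨h.zero, fun k v hk hv => by_contra fun h0 => ?_⟩
  obtain ⟨l, hl⟩ := h.wt _ v hv h0
  have : ((k + l : ℕ) : ℂ) = 0 := by push_cast; linear_combination hl
  rw [Nat.cast_eq_zero] at this
  lia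

theorem TL.of_injective (h : TL a N) (f : M →ₗ[U] N) (hf : Function.Injective f) : TL a M :=
  ⟨fun v => hf (by rw [map_smul, h.zero, map_zero]), fun k v hk hv =>
    hf (by rw [h.wt k _ hk (map_mem_eig f hv), map_zero])⟩

theorem TW.of_injective (h : TW a N) (f : M →ₗ[U] N) (hf : Function.Injective f) : TW a M := by
  refine ⟨(h.tl.of_injective f hf).zero, fun v => ?_, fun c v hv h0 => ?_⟩
  · obtain ⟨y, hy, hys⟩ := (Submodule.mem_iSup_iff_exists_finsupp _ _).1 (h.top (f v))
    have hmem (c : ℂ) : y c ∈ LinearMap.range f := by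
      rw [← Submodule.Quotient.mk_eq_zero]
      let g := (LinearMap.range f).mkQ
      have hg : ∑ c ∈ y.support, g (y c) = 0 := by
        rw [← map_sum]
        exact (Submodule.Quotient.mk_eq_zero _).2 ⟨v, hys.symm⟩
      by_cases hc : c ∈ y.support
      · refine (eq_of_sub_mem_iSup_eig (c := c) (zero_mem _) (map_mem_eig g (hy c)) ?_).symm
        rw [← hg, ← Finset.sum_erase_add _ _ hc, add_sub_cancel_right]
        exact sum_mem fun d hd => Submodule.mem_iSup_of_mem d
          (Submodule.mem_iSup_of_mem (Finset.ne_of_mem_erase hd) (map_mem_eig g (hy d)))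
      · rw [Finsupp.notMem_support_iff.1 hc]; rfl
    choose x hx using hmem
    have hv : v = ∑ c ∈ y.support, x c := by
      apply hf
      rw [← hys, map_sum]
      exact Finset.sum_congr rfl fun c _ => (hx c).symm
    rw [hv]
    exact sum_mem fun c _ => Submodule.mem_iSup_of_mem c
      (of_map_mem_eig f hf (by rw [hx]; exact hy c))
  · exact h.wt c (f v) (map_mem_eig f hv) fun h1 => h0 (hf (by rw [h1, map_zero]))

theorem TW.of_surjective (h : TW a M) (f : M →ₗ[U] N) (hf : Function.Surjective f) : TW a N := by
  refine ⟨fun v => ?_, fun v => ?_, fun c v hv h0 => ?_⟩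
  · obtain ⟨x, rfl⟩ := hf v
    rw [← map_smul, h.zero, map_zero]
  · obtain ⟨x, rfl⟩ := hf v
    have : (⨆ c, eig M c) ≤ (⨆ c, eig N c).comap (f.restrictScalars ℂ) :=
      iSup_le fun c x hx => Submodule.mem_iSup_of_mem c (map_mem_eig f hx)
    exact this (h.top x)
  · obtain ⟨x, hx, rfl⟩ := exists_eig_lift h.top f hf hv
    exact h.wt c x hx fun h1 => h0 (by rw [h1, map_zero])

theorem TW.submodule (h : TW a M) (N : Submodule U M) : TW a N :=
  h.of_injective N.subtype N.injective_subtype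

theorem TW.quotient (h : TW a M) (N : Submodule U M) : TW a (M ⧸ N) :=
  h.of_surjective N.mkQ N.mkQ_surjective

/-- A module generated by a weight vector of weight in `λ + ℤ` is a weight module. -/
theorem mem_iSup_eig_of_cyclic {b : ℂ} {w : M} (hw : w ∈ eig M b) (u : U) :
    u • w ∈ ⨆ n : ℤ, eig M (b + n) := by
  have : (⨆ n, gr n) ≤
      (⨆ n : ℤ, eig M (b + n)).comap ((LinearMap.toSpanSingleton U M w).restrictScalars ℂ) :=
    iSup_le fun n u hu => Submodule.mem_iSup_of_mem n (gr_smul_mem hu hw)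
  exact this (mem_iSup_gr u)

theorem TL.tw_of_cyclic (h : TL a M) {i : ℕ} {w : M} (hw : w ∈ eig M (a - i))
    (hgen : ∀ y : M, ∃ u : U, u • w = y) : TW a M := by
  refine ⟨h.zero, fun y => ?_, fun c y hy h0 => ?_⟩
  · obtain ⟨u, rfl⟩ := hgen y
    have : (⨆ n : ℤ, eig M (a - i + n)) ≤ ⨆ c, eig M c :=
      iSup_le fun n => le_iSup (eig M) (a - i + n)
    exact this (mem_iSup_eig_of_cyclic hw u)
  · have hc : ∃ n : ℤ, c = a - i + n := by
      by_contra! hne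
      obtain ⟨u, rfl⟩ := hgen y
      have h1 : (⨆ n : ℤ, eig M (a - i + n)) ≤ ⨆ (d : ℂ) (_ : d ≠ c), eig M d :=
        iSup_le fun n => le_iSup₂_of_le (a - i + n) (hne n).symm le_rfl
      refine h0 (eq_of_sub_mem_iSup_eig hy (zero_mem _) ?_)
      rw [sub_zero]
      exact h1 (mem_iSup_eig_of_cyclic hw u)
    obtain ⟨n, rfl⟩ := hc
    by_cases hn : n ≤ i
    · refine ⟨(i - n).toNat, ?_⟩
      have : (((i - n).toNat : ℤ) : ℂ) = i - n := by
        rw [Int.toNat_of_nonneg (by lia)]; push_cast; ring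
      rw [Int.cast_natCast] at this
      rw [this]; ring
    · refine absurd (h.wt (n - i).toNat y (by lia) ?_) h0
      have : (((n - i).toNat : ℤ) : ℂ) = n - i := by
        rw [Int.toNat_of_nonneg (by lia)]; push_cast; ring
      rw [Int.cast_natCast] at this
      rw [this]
      convert hy using 2
      ring

end Weights

section Dual

/-- The linear dual of a `U`-module, with `U` acting through the anti-involution. -/
def Tw (M : Type) [AddCommGroup M] [Module ℂ M] : Type := Module.Dual ℂ M

variable {M : Type} [AddCommGroup M] [Module ℂ M]

instance (M : Type) [AddCommGroup M] [Module ℂ M] : AddCommGroup (Tw M) :=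
  inferInstanceAs (AddCommGroup (Module.Dual ℂ M))
instance (M : Type) [AddCommGroup M] [Module ℂ M] : Module ℂ (Tw M) :=
  inferInstanceAs (Module ℂ (Module.Dual ℂ M))
instance (M : Type) [AddCommGroup M] [Module ℂ M] : FunLike (Tw M) M ℂ :=
  inferInstanceAs (FunLike (Module.Dual ℂ M) M ℂ)
instance (M : Type) [AddCommGroup M] [Module ℂ M] : LinearMapClass (Tw M) ℂ M ℂ :=
  inferInstanceAs (LinearMapClass (Module.Dual ℂ M) ℂ M ℂ)

theorem Tw.ext {g g' : Tw M} (h : ∀ v, g v = g' v) : g = g' := LinearMap.ext h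
theorem Tw.add_apply (g g' : Tw M) (v : M) : (g + g') v = g v + g' v := rfl
theorem Tw.zero_apply (v : M) : (0 : Tw M) v = 0 := rfl
theorem Tw.complex_smul_apply (c : ℂ) (g : Tw M) (v : M) : (c • g) v = c * g v := rfl

variable [Module U M] [IsScalarTower ℂ U M]

instance : SMul U (Tw M) :=
  ⟨fun u g => LinearMap.comp (R₁ := ℂ) (M₁ := M) (M₂ := M) g (act M (anti u))⟩

theorem Tw.smul_apply (u : U) (g : Tw M) (v : M) : (u • g) v = g (anti u • v) := rfl

instance : Module U (Tw M) where
  one_smul g := Tw.ext fun v => by rw [Tw.smul_apply, anti_one, one_smul]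
  mul_smul a b g := Tw.ext fun v => by simp only [Tw.smul_apply, anti_mul, mul_smul]
  smul_zero a := Tw.ext fun v => rfl
  smul_add a g g' := Tw.ext fun v => rfl
  add_smul a b g := Tw.ext fun v => by
    simp only [Tw.smul_apply, Tw.add_apply, map_add, add_smul]
  zero_smul g := Tw.ext fun v => by
    simp only [Tw.smul_apply, Tw.zero_apply, map_zero, zero_smul]

instance : IsScalarTower ℂ U (Tw M) where
  smul_assoc c u g := Tw.ext fun v => by
    simp only [Tw.smul_apply, Tw.complex_smul_apply, map_smul, smul_assoc, smul_eq_mul]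

theorem Tw.mem_eig {g : Tw M} {c : ℂ} : g ∈ eig (Tw M) c ↔ ∀ v : M, g (H • v) = c * g v := by
  rw [Schrodinger.mem_eig]
  constructor
  · intro h v
    rw [← Tw.complex_smul_apply, ← h, Tw.smul_apply, anti_H]
  · intro h
    refine Tw.ext fun v => ?_
    rw [Tw.smul_apply, anti_H, h, Tw.complex_smul_apply]

/-- A weight functional vanishes on vectors of a different weight. -/
theorem Tw.apply_eq_zero {g : Tw M} {c d : ℂ} (hg : g ∈ eig (Tw M) c) (hcd : d ≠ c) {v : M}
    (hv : v ∈ eig M d) : g v = 0 := by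
  have h := Tw.mem_eig.1 hg v
  rw [Schrodinger.mem_eig.1 hv, map_smul, smul_eq_mul, ← sub_eq_zero, ← sub_mul, mul_eq_zero,
    sub_eq_zero] at h
  exact h.resolve_left hcd

theorem Tw.eq_zero (hM : ∀ v : M, v ∈ ⨆ c, eig M c) {g : Tw M}
    (h : ∀ c, ∀ v ∈ eig M c, g v = 0) : g = 0 := by
  have : (⨆ c, eig M c) ≤ LinearMap.ker (R := ℂ) (M := M) g := iSup_le h
  exact Tw.ext fun v => this (hM v)

theorem TW.tl_tw {a : ℂ} (h : TW a M) : TL a (Tw M) := by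
  refine ⟨fun g => Tw.ext fun v => ?_, fun k g hk hg => Tw.eq_zero h.top fun c v hv => ?_⟩
  · rw [Tw.smul_apply, anti_Z, h.zero, map_zero]; rfl
  · by_cases hc : c = a + k
    · rw [h.tl.wt k v hk (hc ▸ hv), map_zero]
    · exact Tw.apply_eq_zero hg hc hv

/-- Every functional on a weight space extends to a weight functional. -/
theorem exists_weight_functional (hM : ∀ v : M, v ∈ ⨆ c, eig M c) (c : ℂ)
    (φ : Module.Dual ℂ (eig M c)) :
    ∃ g : Tw M, g ∈ eig (Tw M) c ∧ ∀ v : eig M c, g v = φ v := by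
  have hc : IsCompl (eig M c) (⨆ (d : ℂ) (_ : d ≠ c), eig M d) := by
    refine ⟨Module.End.eigenspaces_iSupIndep (act M H) c, codisjoint_iff.2 ?_⟩
    rw [← iSup_split_single (eig M) c, eq_top_iff]
    exact fun v _ => hM v
  let g : Tw M := LinearMap.comp (R₁ := ℂ) (M₁ := M) φ (Submodule.projectionOnto _ _ hc)
  have hg (v : M) : g v = φ (Submodule.projectionOnto _ _ hc v) := rfl
  have hgv (v : eig M c) : g v = φ v := by
    rw [hg, Submodule.projectionOnto_apply_left]
  refine ⟨g, Schrodinger.mem_eig.2 (sub_eq_zero.1 (Tw.eq_zero hM fun d v hv => ?_)), hgv⟩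
  have e : (H • g - c • g) v = g (H • v) - c * g v := by
    rw [← Tw.complex_smul_apply, sub_eq_add_neg, Tw.add_apply, Tw.smul_apply, anti_H]; rfl
  rw [e, Schrodinger.mem_eig.1 hv, map_smul, smul_eq_mul, ← sub_mul]
  by_cases hd : d = c
  · rw [hd, sub_self, zero_mul]
  · have : v ∈ ⨆ (d : ℂ) (_ : d ≠ c), eig M d :=
      Submodule.mem_iSup_of_mem d (Submodule.mem_iSup_of_mem hd hv)
    rw [hg, (Submodule.projectionOnto_apply_eq_zero_iff hc).2 this, map_zero, mul_zero]

end Dual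

section Verma

variable {N : Type} [AddCommGroup N] [Module U N] [Module ℂ N] [IsScalarTower ℂ U N]
variable {a : ℂ}

/-- The homomorphism from a Verma module given by a highest weight vector. -/
def vermaLift (w : N) (hE : E • w = 0) (hP : P • w = 0) (hH : w ∈ eig N a) (hZ : Z • w = 0) :
    Verma a 0 →ₗ[U] N :=
  Submodule.liftQ _ (LinearMap.toSpanSingleton U N w) <| by
    refine Submodule.span_le.2 ?_
    rintro u (rfl | rfl | rfl | rfl)
    · exact hE
    · exact hP
    · change (H - sc a) • w = 0
      rw [sub_smul, sc_smul, mem_eig.1 hH, sub_self]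
    · change (Z - sc 0) • w = 0
      rw [sub_smul, sc_smul, hZ, zero_smul, sub_self]

theorem vermaLift_hwVec (w : N) (hE : E • w = 0) (hP : P • w = 0) (hH : w ∈ eig N a)
    (hZ : Z • w = 0) : vermaLift w hE hP hH hZ (hwVec a 0) = w :=
  one_smul U w

theorem exists_smul_hwVec (y : Verma a 0) : ∃ u : U, u • hwVec a 0 = y := by
  obtain ⟨u, rfl⟩ := Submodule.Quotient.mk_surjective _ y
  exact ⟨u, by rw [hwVec, ← Submodule.Quotient.mk_smul, smul_eq_mul, mul_one]⟩

theorem smul_hwVec_eq_zero {u : U} (hu : u ∈ ({E, P, H - sc a, Z - sc 0} : Set U)) :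
    u • hwVec a 0 = 0 := by
  rw [hwVec, ← Submodule.Quotient.mk_smul, smul_eq_mul, mul_one, Submodule.Quotient.mk_eq_zero]
  exact Submodule.subset_span hu

theorem E_smul_hwVec : E • hwVec a 0 = 0 := smul_hwVec_eq_zero (by simp)
theorem P_smul_hwVec : P • hwVec a 0 = 0 := smul_hwVec_eq_zero (by simp)
theorem hwVec_mem_eig : hwVec a 0 ∈ eig (Verma a 0) a := by
  have := smul_hwVec_eq_zero (a := a) (u := H - sc a) (by simp)
  rwa [sub_smul, sub_eq_zero, sc_smul, ← mem_eig] at this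
theorem Z_smul_verma (y : Verma a 0) : Z • y = 0 := by
  obtain ⟨u, rfl⟩ := exists_smul_hwVec y
  have := smul_hwVec_eq_zero (a := a) (u := Z - sc 0) (by simp)
  rw [sub_smul, sub_eq_zero, sc_smul, zero_smul] at this
  rw [← mul_smul, Z_mul, mul_smul, this, smul_zero]

theorem F_pow_mul_Q_pow_mem_gr (m n : ℕ) : F ^ m * Q ^ n ∈ gr (-(2 * m + n)) := by
  have hF : F ^ m ∈ gr (-(2 * m)) := by
    induction m with
    | zero => simp [mem_gr]
    | succ m ih =>
      rw [pow_succ]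
      convert mul_mem_gr ih F_mem_gr using 2
      push_cast; ring
  have hQ : Q ^ n ∈ gr (-n) := by
    induction n with
    | zero => simp [mem_gr]
    | succ n ih =>
      rw [pow_succ]
      convert mul_mem_gr ih Q_mem_gr using 2
      push_cast; ring
  convert mul_mem_gr hF hQ using 2
  ring

/-- The monomial basis vectors `f ^ m q ^ n v` of a Verma module. -/
def vermaMon (a : ℂ) (x : ℕ × ℕ) : Verma a 0 := (F ^ x.1 * Q ^ x.2) • hwVec a 0

theorem vermaMon_mem_eig (x : ℕ × ℕ) :
    vermaMon a x ∈ eig (Verma a 0) (a - ((2 * x.1 + x.2 : ℕ) : ℂ)) := by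
  have h := gr_smul_mem (F_pow_mul_Q_pow_mem_gr x.1 x.2) (hwVec_mem_eig (a := a))
  have e : a + ((-(2 * x.1 + x.2) : ℤ) : ℂ) = a - ((2 * x.1 + x.2 : ℕ) : ℂ) := by push_cast; ring
  rwa [e] at h

theorem F_smul_vermaMon (m n : ℕ) : F • vermaMon a (m, n) = vermaMon a (m + 1, n) := by
  simp only [vermaMon, ← mul_smul, ← mul_assoc, pow_succ']

theorem Q_smul_vermaMon (m n : ℕ) : Q • vermaMon a (m, n) = vermaMon a (m, n + 1) := by
  have h : Commute Q (F ^ m) := (Commute.pow_right (F_mul_Q.symm : Commute Q F) m)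
  simp only [vermaMon, ← mul_smul, ← mul_assoc, pow_succ']
  rw [h.eq]

theorem H_smul_vermaMon (m n : ℕ) :
    H • vermaMon a (m, n) = (a - ((2 * m + n : ℕ) : ℂ)) • vermaMon a (m, n) :=
  mem_eig.1 (vermaMon_mem_eig (m, n))

theorem smul_mem_span_vermaMon (u : U) {y : Verma a 0}
    (hy : y ∈ Submodule.span ℂ (Set.range (vermaMon a))) :
    u • y ∈ Submodule.span ℂ (Set.range (vermaMon a)) := by
  let S := Submodule.span ℂ (Set.range (vermaMon a))
  have key (u : U) (h : ∀ m n, u • vermaMon a (m, n) ∈ S) : ∀ y ∈ S, u • y ∈ S := by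
    have : S ≤ S.comap (act _ u) := by
      refine Submodule.span_le.2 ?_
      rintro _ ⟨⟨m, n⟩, rfl⟩
      exact h m n
    exact this
  have mon (m n : ℕ) : vermaMon a (m, n) ∈ S := Submodule.subset_span ⟨_, rfl⟩
  have hF := key F fun m n => by rw [F_smul_vermaMon]; exact mon _ _
  have hQ := key Q fun m n => by rw [Q_smul_vermaMon]; exact mon _ _
  have hH := key H fun m n => by rw [H_smul_vermaMon]; exact S.smul_mem _ (mon _ _)
  have hZ : ∀ y ∈ S, Z • y ∈ S := fun y _ => by rw [Z_smul_verma]; exact zero_mem _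
  have hP := key P fun m n => by
    induction m with
    | zero =>
      induction n with
      | zero =>
        have : P • vermaMon a (0, 0) = 0 := by simp [vermaMon, P_smul_hwVec]
        rw [this]; exact zero_mem _
      | succ n ih =>
        rw [← Q_smul_vermaMon, ← mul_smul, P_mul_Q, add_smul, mul_smul, Z_smul_verma, add_zero]
        exact hQ _ ih
    | succ m ih =>
      rw [← F_smul_vermaMon, ← mul_smul, eq_sub_of_add_eq F_mul_P.symm, sub_smul, mul_smul]
      exact sub_mem (hF _ ih) (hQ _ (mon _ _))
  have hE := key E fun m n => by
    induction m with
    | zero =>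
      induction n with
      | zero =>
        have : E • vermaMon a (0, 0) = 0 := by simp [vermaMon, E_smul_hwVec]
        rw [this]; exact zero_mem _
      | succ n ih =>
        rw [← Q_smul_vermaMon, ← mul_smul, E_mul_Q, add_smul, mul_smul]
        exact add_mem (hQ _ ih) (hP _ (mon _ _))
    | succ m ih =>
      rw [← F_smul_vermaMon, ← mul_smul, E_mul_F, add_smul, mul_smul]
      exact add_mem (hF _ ih) (hH _ (mon _ _))
  refine mem_of_gen_mem
    { carrier := {u | ∀ y ∈ S, u • y ∈ S}
      mul_mem' := fun {a b} ha hb y hy => by rw [mul_smul]; exact ha _ (hb _ hy)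
      add_mem' := fun {a b} ha hb y hy => by rw [add_smul]; exact add_mem (ha _ hy) (hb _ hy)
      algebraMap_mem' := fun r y hy => by rw [algebraMap_smul]; exact S.smul_mem r hy } ?_ u y hy
  rintro (_ | _ | _ | _ | _ | _)
  exacts [hE, hH, hF, hP, hQ, hZ]

theorem span_vermaMon : ⊤ ≤ Submodule.span ℂ (Set.range (vermaMon a)) := by
  intro y _
  obtain ⟨u, rfl⟩ := exists_smul_hwVec y
  refine smul_mem_span_vermaMon u (Submodule.subset_span ⟨(0, 0), ?_⟩)
  simp [vermaMon]

/-- The polynomial model of the Verma module of central charge zero. -/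
def Model (_ : ℂ) : Type := ℕ × ℕ →₀ ℂ

instance : AddCommGroup (Model a) := inferInstanceAs (AddCommGroup (ℕ × ℕ →₀ ℂ))
instance : Module ℂ (Model a) := inferInstanceAs (Module ℂ (ℕ × ℕ →₀ ℂ))

/-- The operators by which the generators act on the polynomial model. -/
def modelGen (a : ℂ) : Gen → Module.End ℂ (ℕ × ℕ →₀ ℂ)
  | .E => Finsupp.lsum ℂ fun x =>
      (x.1 * (a - x.2 - x.1 + 1) : ℂ) • Finsupp.lsingle (x.1 - 1, x.2)
  | .H => Finsupp.lsum ℂ fun x => (a - 2 * x.1 - x.2 : ℂ) • Finsupp.lsingle x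
  | .F => Finsupp.lsum ℂ fun x => Finsupp.lsingle (x.1 + 1, x.2)
  | .P => Finsupp.lsum ℂ fun x => (-x.1 : ℂ) • Finsupp.lsingle (x.1 - 1, x.2 + 1)
  | .Q => Finsupp.lsum ℂ fun x => Finsupp.lsingle (x.1, x.2 + 1)
  | .Z => 0

theorem modelGen_E (m n : ℕ) (c : ℂ) : modelGen a .E (Finsupp.single (m, n) c) =
    Finsupp.single (m - 1, n) (m * (a - n - m + 1) * c) := by
  simp [modelGen]

theorem modelGen_H (m n : ℕ) (c : ℂ) : modelGen a .H (Finsupp.single (m, n) c) =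
    Finsupp.single (m, n) ((a - 2 * m - n) * c) := by
  simp [modelGen]

theorem modelGen_F (m n : ℕ) (c : ℂ) : modelGen a .F (Finsupp.single (m, n) c) =
    Finsupp.single (m + 1, n) c := by
  simp [modelGen]

theorem modelGen_P (m n : ℕ) (c : ℂ) : modelGen a .P (Finsupp.single (m, n) c) =
    Finsupp.single (m - 1, n + 1) (-m * c) := by
  simp [modelGen]

theorem modelGen_Q (m n : ℕ) (c : ℂ) : modelGen a .Q (Finsupp.single (m, n) c) =
    Finsupp.single (m, n + 1) c := by
  simp [modelGen]

theorem modelGen_rel ⦃x y : FA⦄ (h : Rel x y) :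
    FreeAlgebra.lift ℂ (modelGen a) x = FreeAlgebra.lift ℂ (modelGen a) y := by
  have two : (2 : Module.End ℂ (ℕ × ℕ →₀ ℂ)) = (2 : ℂ) • 1 := by rw [two_smul, one_add_one_eq_two]
  have hz : modelGen a .Z = 0 := rfl
  cases h <;>
  · simp only [ιg, map_mul, map_add, map_sub, map_ofNat, FreeAlgebra.lift_ι_apply, two]
    refine Finsupp.lhom_ext' fun ⟨m, n⟩ => LinearMap.ext_ring ?_
    simp only [LinearMap.comp_apply, Finsupp.lsingle_apply, Module.End.mul_apply,
      LinearMap.add_apply, LinearMap.sub_apply, LinearMap.smul_apply, hz,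
      LinearMap.zero_apply, map_zero, add_zero, modelGen_E, modelGen_F, modelGen_H, modelGen_P,
      modelGen_Q, smul_mul_assoc, one_mul, Finsupp.smul_single, smul_eq_mul, mul_one,
      Nat.add_sub_cancel]
    all_goals rcases m with _ | _ | m <;>
    simp only [Nat.add_sub_cancel, Nat.cast_zero, zero_mul, neg_zero, Finsupp.single_zero, add_zero,
      zero_add, mul_zero, zero_tsub, sub_zero, Nat.sub_self, ← Finsupp.single_add,
      ← Finsupp.single_sub] <;>
    first
    | done
    | (congr 1; done)
    | (congr 1; push_cast; ring1)
    | simp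

instance : Module U (Model a) :=
  Module.compHom (ℕ × ℕ →₀ ℂ) (uLift (modelGen a) modelGen_rel).toRingHom

theorem model_smul (u : U) (y : Model a) : u • y = uLift (modelGen a) modelGen_rel u y := rfl

instance : IsScalarTower ℂ U (Model a) where
  smul_assoc c u y := by rw [model_smul, map_smul]; rfl

theorem gen_smul_model (g : Gen) (y : Model a) : gen g • y = modelGen a g y := by
  rw [model_smul, uLift_gen]

/-- The basis vectors of the polynomial model. -/
def modelMon (a : ℂ) (x : ℕ × ℕ) : Model a := Finsupp.single x (1 : ℂ)

theorem F_pow_mul_Q_pow_smul_modelMon (m n : ℕ) :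
    (F ^ m * Q ^ n) • modelMon a (0, 0) = modelMon a (m, n) := by
  have hQ (n : ℕ) : Q ^ n • modelMon a (0, 0) = modelMon a (0, n) := by
    induction n with
    | zero => simp
    | succ n ih => rw [pow_succ', mul_smul, ih]; exact (gen_smul_model .Q _).trans (modelGen_Q ..)
  rw [mul_smul, hQ]
  induction m with
  | zero => simp
  | succ m ih => rw [pow_succ', mul_smul, ih]; exact (gen_smul_model .F _).trans (modelGen_F ..)

/-- The homomorphism from the Verma module to its polynomial model. -/
def toModel (a : ℂ) : Verma a 0 →ₗ[U] Model a :=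
  vermaLift (modelMon a (0, 0))
    (show gen .E • _ = _ from (gen_smul_model .E _).trans <| (modelGen_E ..).trans <| by simp; rfl)
    (show gen .P • _ = _ from (gen_smul_model .P _).trans <| (modelGen_P ..).trans <| by simp; rfl)
    (mem_eig.2 <| (gen_smul_model .H _).trans <| (modelGen_H ..).trans <| by
      simp only [Nat.cast_zero, mul_zero, sub_zero, mul_one]
      exact ((Finsupp.smul_single a (0, 0) (1 : ℂ)).trans (by simp)).symm)
    (gen_smul_model .Z _)

theorem toModel_vermaMon (x : ℕ × ℕ) : toModel a (vermaMon a x) = modelMon a x := by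
  have h : toModel a (hwVec a 0) = modelMon a (0, 0) := vermaLift_hwVec ..
  rw [vermaMon, map_smul, h, F_pow_mul_Q_pow_smul_modelMon]

theorem linearIndependent_vermaMon : LinearIndependent ℂ (vermaMon a) := by
  refine LinearIndependent.of_comp ((toModel a).restrictScalars ℂ) ?_
  have : ((toModel a).restrictScalars ℂ) ∘ vermaMon a = modelMon a := funext toModel_vermaMon
  rw [this]
  exact Finsupp.linearIndependent_single_one ℂ (ℕ × ℕ)

/-- The monomial basis of a Verma module. -/
def vermaBasis (a : ℂ) : Module.Basis (ℕ × ℕ) ℂ (Verma a 0) :=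
  Module.Basis.mk linearIndependent_vermaMon span_vermaMon

@[simp] theorem vermaBasis_apply (x : ℕ × ℕ) : vermaBasis a x = vermaMon a x :=
  Module.Basis.mk_apply ..

theorem vermaBasis_repr_H_smul (y : Verma a 0) (x : ℕ × ℕ) :
    (vermaBasis a).repr (H • y) x = (a - ((2 * x.1 + x.2 : ℕ) : ℂ)) * (vermaBasis a).repr y x := by
  let f : Verma a 0 →ₗ[ℂ] ℂ := (vermaBasis a).coord x ∘ₗ act _ H
  let g : Verma a 0 →ₗ[ℂ] ℂ := (a - ((2 * x.1 + x.2 : ℕ) : ℂ)) • (vermaBasis a).coord x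
  suffices h : f = g from LinearMap.congr_fun h y
  refine (vermaBasis a).ext fun z => ?_
  have h1 : f (vermaBasis a z) = (vermaBasis a).repr (H • vermaBasis a z) x := rfl
  have h2 : g (vermaBasis a z) = (a - ((2 * x.1 + x.2 : ℕ) : ℂ)) *
    (vermaBasis a).repr (vermaBasis a z) x := rfl
  have h3 : H • vermaBasis a z = (a - ((2 * z.1 + z.2 : ℕ) : ℂ)) • vermaBasis a z := by
    rw [vermaBasis_apply]; exact H_smul_vermaMon z.1 z.2
  rw [h1, h2, h3, map_smul, Module.Basis.repr_self, Finsupp.smul_apply, smul_eq_mul,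
    Finsupp.single_apply]
  split_ifs with h
  · rw [h]
  · simp

theorem vermaBasis_repr_eq_zero {c : ℂ} {y : Verma a 0} (hy : y ∈ eig _ c) {x : ℕ × ℕ}
    (hx : c ≠ a - ((2 * x.1 + x.2 : ℕ) : ℂ)) : (vermaBasis a).repr y x = 0 := by
  have h := vermaBasis_repr_H_smul y x
  rw [mem_eig.1 hy, map_smul, Finsupp.smul_apply, smul_eq_mul, ← sub_eq_zero, ← sub_mul,
    mul_eq_zero, sub_eq_zero] at h
  exact h.resolve_left hx

theorem finiteDimensional_eig_verma (c : ℂ) : FiniteDimensional ℂ (eig (Verma a 0) c) := by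
  classical
  by_cases hc : ∃ k : ℕ, c = a - k
  · obtain ⟨k, rfl⟩ := hc
    let s : Finset (ℕ × ℕ) := Finset.range (k + 1) ×ˢ Finset.range (k + 1)
    have hle : eig (Verma a 0) (a - k) ≤ Submodule.span ℂ (s.image (vermaMon a) : Set _) := by
      intro y hy
      rw [← (vermaBasis a).linearCombination_repr y, Finsupp.linearCombination_apply]
      refine sum_mem fun x hx => Submodule.smul_mem _ _ (Submodule.subset_span ?_)
      rw [Finsupp.mem_support_iff] at hx
      have hk : (a - k : ℂ) = a - ((2 * x.1 + x.2 : ℕ) : ℂ) := by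
        by_contra h; exact hx (vermaBasis_repr_eq_zero hy h)
      rw [sub_right_inj, Nat.cast_inj] at hk
      rw [vermaBasis_apply]
      refine Finset.mem_coe.2 (Finset.mem_image_of_mem _ ?_)
      simp only [s, Finset.mem_product, Finset.mem_range]
      lia
    exact Submodule.finiteDimensional_of_le hle
  · push Not at hc
    have : eig (Verma a 0) c = ⊥ := by
      refine (Submodule.eq_bot_iff _).2 fun y hy => (vermaBasis a).repr.injective ?_
      rw [map_zero]
      exact Finsupp.ext fun x => vermaBasis_repr_eq_zero hy (hc _)
    rw [this]
    infer_instance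

theorem tw_verma (b : ℂ) (j : ℕ) : TW b (Verma (b - j) 0) := by
  refine ⟨Z_smul_verma, fun y => ?_, fun c y hy h0 => ?_⟩
  · have : Submodule.span ℂ (Set.range (vermaMon (b - j))) ≤ ⨆ c, eig _ c :=
      Submodule.span_le.2 (by
        rintro _ ⟨x, rfl⟩
        exact Submodule.mem_iSup_of_mem _ (vermaMon_mem_eig x))
    exact this (span_vermaMon trivial)
  · by_contra! h
    refine h0 ((vermaBasis _).repr.injective ?_)
    rw [map_zero]
    refine Finsupp.ext fun x => vermaBasis_repr_eq_zero hy fun hc => h (j + (2 * x.1 + x.2)) ?_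
    rw [hc]; push_cast; ring

theorem hwVec_eq_vermaMon : hwVec a 0 = vermaMon a (0, 0) := by simp [vermaMon]

/-- The coordinate along the highest weight vector. -/
def topCoord (a : ℂ) : Module.Dual ℂ (Verma a 0) := (vermaBasis a).coord (0, 0)

theorem topCoord_vermaMon (x : ℕ × ℕ) :
    topCoord a (vermaMon a x) = if x = (0, 0) then 1 else 0 := by
  rw [topCoord, Module.Basis.coord_apply, ← vermaBasis_apply, Module.Basis.repr_self,
    Finsupp.single_apply]

theorem topCoord_hwVec : topCoord a (hwVec a 0) = 1 := by
  rw [hwVec_eq_vermaMon, topCoord_vermaMon, if_pos rfl]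

theorem topCoord_H_smul (y : Verma a 0) : topCoord a (H • y) = a * topCoord a y := by
  simpa [topCoord] using vermaBasis_repr_H_smul y (0, 0)

theorem topCoord_F_smul (y : Verma a 0) : topCoord a (F • y) = 0 := by
  have h : topCoord a ∘ₗ act _ F = 0 := (vermaBasis a).ext fun x => by
    rw [LinearMap.comp_apply, act_apply, vermaBasis_apply, F_smul_vermaMon, topCoord_vermaMon]
    simp
  exact LinearMap.congr_fun h y

theorem topCoord_Q_smul (y : Verma a 0) : topCoord a (Q • y) = 0 := by
  have h : topCoord a ∘ₗ act _ Q = 0 := (vermaBasis a).ext fun x => by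
    rw [LinearMap.comp_apply, act_apply, vermaBasis_apply, Q_smul_vermaMon, topCoord_vermaMon]
    simp
  exact LinearMap.congr_fun h y

theorem eq_topCoord_smul_hwVec {y : Verma a 0} (hy : y ∈ eig _ a) :
    y = topCoord a y • hwVec a 0 := by
  refine (vermaBasis a).repr.injective (Finsupp.ext fun x => ?_)
  rw [map_smul, hwVec_eq_vermaMon, ← vermaBasis_apply, Module.Basis.repr_self, Finsupp.smul_apply,
    Finsupp.single_apply]
  split_ifs with hx
  · rw [← hx]; simp [topCoord]
  · rw [smul_zero]
    refine vermaBasis_repr_eq_zero hy fun h => hx ?_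
    have : ((2 * x.1 + x.2 : ℕ) : ℂ) = 0 := by linear_combination h
    rw [Nat.cast_eq_zero] at this
    ext <;> simp <;> lia

theorem topCoord_anti_smul (w : U) :
    topCoord a (anti w • hwVec a 0) = topCoord a (w • hwVec a 0) := by
  -- the top functional is a highest weight vector of the twisted dual
  let t : Tw (Verma a 0) := topCoord a
  have hE : E • t = 0 := Tw.ext fun v => by
    rw [Tw.smul_apply, anti_E, neg_smul, map_neg]
    exact neg_eq_zero.2 (topCoord_F_smul v)
  have hP : P • t = 0 := Tw.ext fun v => by
    rw [Tw.smul_apply, anti_P]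
    exact topCoord_Q_smul v
  have hH : t ∈ eig (Tw (Verma a 0)) a := Tw.mem_eig.2 topCoord_H_smul
  have hZ : Z • t = 0 := Tw.ext fun v => by
    rw [Tw.smul_apply, anti_Z, Z_smul_verma]; exact map_zero t
  let Φ := vermaLift t hE hP hH hZ
  have hΦ : Φ (hwVec a 0) = t := vermaLift_hwVec ..
  have h1 (w : U) : topCoord a (anti w • hwVec a 0) = Φ (w • hwVec a 0) (hwVec a 0) := by
    rw [Φ.map_smul, hΦ]; rfl
  have h2 : (Module.Dual.eval ℂ (Verma a 0) (hwVec a 0)) ∘ₗ (Φ.restrictScalars ℂ) = topCoord a := by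
    refine (vermaBasis a).ext fun x => ?_
    rw [vermaBasis_apply, topCoord_vermaMon]
    change Φ (vermaMon a x) (hwVec a 0) = _
    split_ifs with hx
    · rw [hx, ← hwVec_eq_vermaMon, hΦ]; exact topCoord_hwVec
    · refine Tw.apply_eq_zero (map_mem_eig Φ (vermaMon_mem_eig x)) (fun h => hx ?_) hwVec_mem_eig
      have : ((2 * x.1 + x.2 : ℕ) : ℂ) = 0 := by linear_combination h
      rw [Nat.cast_eq_zero] at this
      ext <;> simp <;> lia
  rw [h1]
  exact LinearMap.congr_fun h2 (w • hwVec a 0)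

end Verma

section Simple

variable {a : ℂ}

theorem sub_topCoord_smul_mem (y : Verma a 0) :
    y - topCoord a y • hwVec a 0 ∈ ⨆ (d : ℂ) (_ : d ≠ a), eig (Verma a 0) d := by
  let S := ⨆ (d : ℂ) (_ : d ≠ a), eig (Verma a 0) d
  let f : Verma a 0 →ₗ[ℂ] Verma a 0 := LinearMap.id - (topCoord a).smulRight (hwVec a 0)
  have h : ⊤ ≤ S.comap f := by
    refine span_vermaMon.trans (Submodule.span_le.2 ?_)
    rintro _ ⟨x, rfl⟩
    change vermaMon a x - topCoord a (vermaMon a x) • hwVec a 0 ∈ S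
    rw [topCoord_vermaMon]
    split_ifs with hx
    · rw [hx, ← hwVec_eq_vermaMon, one_smul, sub_self]; exact zero_mem _
    · rw [zero_smul, sub_zero]
      refine Submodule.mem_iSup_of_mem _ (Submodule.mem_iSup_of_mem (fun h => hx ?_)
        (vermaMon_mem_eig x))
      have : ((2 * x.1 + x.2 : ℕ) : ℂ) = 0 := by linear_combination -h
      rw [Nat.cast_eq_zero] at this
      ext <;> simp <;> lia
  exact h trivial

theorem eq_top_of_hwVec_mem {N : Submodule U (Verma a 0)} (h : hwVec a 0 ∈ N) : N = ⊤ := by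
  refine eq_top_iff.2 fun y _ => ?_
  obtain ⟨u, rfl⟩ := exists_smul_hwVec y
  exact N.smul_mem u h

theorem topCoord_eq_zero_of_mem {N : Submodule U (Verma a 0)} (hN : N ≠ ⊤) {y : Verma a 0}
    (hy : y ∈ N) : topCoord a y = 0 := by
  by_contra h0
  have h1 : topCoord a y • hwVec a 0 ∈ N := by
    rw [← Submodule.Quotient.mk_eq_zero]
    refine eq_of_sub_mem_iSup_eig (c := a)
      (map_mem_eig N.mkQ (Submodule.smul_mem _ _ hwVec_mem_eig)) (zero_mem _) ?_
    have h2 : (⨆ (d : ℂ) (_ : d ≠ a), eig (Verma a 0) d) ≤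
        (⨆ (d : ℂ) (_ : d ≠ a), eig (Verma a 0 ⧸ N) d).comap (N.mkQ.restrictScalars ℂ) :=
      iSup₂_le fun d hd z hz => Submodule.mem_iSup_of_mem d
        (Submodule.mem_iSup_of_mem hd (map_mem_eig N.mkQ hz))
    have h3 := neg_mem (h2 (sub_topCoord_smul_mem y))
    have e : N.mkQ (topCoord a y • hwVec a 0) - 0 =
        -(N.mkQ.restrictScalars ℂ (y - topCoord a y • hwVec a 0)) := by
      change _ = -(N.mkQ (y - topCoord a y • hwVec a 0))
      have hy0 : N.mkQ y = 0 := (Submodule.Quotient.mk_eq_zero N).2 hy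
      rw [map_sub, neg_sub, hy0]
    exact e.symm ▸ h3
  refine hN (eq_top_of_hwVec_mem ?_)
  have h4 := N.smul_of_tower_mem (topCoord a y)⁻¹ h1
  rwa [smul_smul, inv_mul_cancel₀ h0, one_smul] at h4

theorem mem_vermaRad {y : Verma a 0} : y ∈ vermaRad a 0 ↔ ∀ u : U, topCoord a (u • y) = 0 := by
  let K : Submodule U (Verma a 0) :=
    { carrier := {y | ∀ u : U, topCoord a (u • y) = 0}
      add_mem' := fun {x y} hx hy u => by rw [smul_add, map_add, hx, hy, add_zero]
      zero_mem' := fun u => by rw [smul_zero, map_zero]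
      smul_mem' := fun v x hx u => by rw [← mul_smul]; exact hx _ }
  have hK : K ≠ ⊤ := by
    intro h
    have h1 : hwVec a 0 ∈ K := h ▸ Submodule.mem_top
    have h2 := h1 1
    rw [one_smul, topCoord_hwVec] at h2
    exact one_ne_zero h2
  have h : vermaRad a 0 = K := by
    refine le_antisymm (sSup_le fun N hN y hy u => ?_) (le_sSup hK)
    exact topCoord_eq_zero_of_mem hN (N.smul_mem u hy)
  rw [h]
  rfl

theorem vermaRad_ne_top : vermaRad a 0 ≠ ⊤ := by
  intro h
  have h1 : hwVec a 0 ∈ vermaRad a 0 := h ▸ Submodule.mem_top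
  have h2 := mem_vermaRad.1 h1 1
  rw [one_smul, topCoord_hwVec] at h2
  exact one_ne_zero h2

theorem le_vermaRad {N : Submodule U (Verma a 0)} (h : N ≠ ⊤) : N ≤ vermaRad a 0 := le_sSup h

/-- The highest weight vector of the simple highest weight module. -/
def simpleVec (a : ℂ) : SimpleHW a 0 := Submodule.Quotient.mk (hwVec a 0)

theorem smul_simpleVec (u : U) :
    u • simpleVec a = Submodule.Quotient.mk (p := vermaRad a 0) (u • hwVec a 0) := rfl

theorem exists_smul_simpleVec (y : SimpleHW a 0) : ∃ u : U, u • simpleVec a = y := by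
  obtain ⟨z, rfl⟩ := Submodule.Quotient.mk_surjective _ y
  obtain ⟨u, rfl⟩ := exists_smul_hwVec z
  exact ⟨u, rfl⟩

theorem isCoatom_vermaRad : IsCoatom (vermaRad a 0) :=
  ⟨vermaRad_ne_top, fun _ hN => by_contra fun h => hN.not_ge (le_vermaRad h)⟩

instance : IsSimpleModule U (SimpleHW a 0) := isSimpleModule_iff_isCoatom.2 isCoatom_vermaRad

theorem simpleVec_ne_zero : simpleVec a ≠ 0 := fun h =>
  vermaRad_ne_top (eq_top_of_hwVec_mem ((Submodule.Quotient.mk_eq_zero _).1 h))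

theorem simpleVec_mem_eig : simpleVec a ∈ eig (SimpleHW a 0) a :=
  map_mem_eig (vermaRad a 0).mkQ hwVec_mem_eig

theorem tw_simpleHW (b : ℂ) (j : ℕ) : TW b (SimpleHW (b - j) 0) := (tw_verma b j).quotient _

theorem exists_eq_smul_simpleVec {y : SimpleHW a 0} (hy : y ∈ eig _ a) :
    ∃ c : ℂ, y = c • simpleVec a := by
  have h := tw_verma a 0
  rw [Nat.cast_zero, sub_zero] at h
  obtain ⟨x, hx, rfl⟩ := exists_eig_lift h.top (vermaRad a 0).mkQ
    (vermaRad a 0).mkQ_surjective hy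
  refine ⟨topCoord a x, ?_⟩
  conv_lhs => rw [eq_topCoord_smul_hwVec hx]
  rfl

theorem topCoord_smul_eq_of_smul_simpleVec_eq {u w : U} (h : u • simpleVec a = w • simpleVec a)
    (s : U) : topCoord a ((s * u) • hwVec a 0) = topCoord a ((s * w) • hwVec a 0) := by
  rw [smul_simpleVec, smul_simpleVec, Submodule.Quotient.eq] at h
  have := mem_vermaRad.1 h s
  rwa [smul_sub, map_sub, sub_eq_zero, ← mul_smul, ← mul_smul] at this

theorem exists_smul_eq_of_isSimpleModule {L : Type} [AddCommGroup L] [Module U L]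
    [IsSimpleModule U L] {y : L} (hy : y ≠ 0) (z : L) : ∃ u : U, u • y = z :=
  IsSimpleModule.toSpanSingleton_surjective U hy z

variable {L : Type} [AddCommGroup L] [Module U L] [Module ℂ L] [IsScalarTower ℂ U L]

/-- Every simple weight module with weights bounded above is a simple highest weight module. -/
theorem exists_equiv_simpleHW [IsSimpleModule U L] (hL : TW a L) :
    ∃ k : ℕ, Nonempty (L ≃ₗ[U] SimpleHW (a - k) 0) := by
  classical
  have hex : ∃ k : ℕ, ∃ w ∈ eig L (a - k), w ≠ 0 := by
    by_contra! hne
    have := IsSimpleModule.nontrivial U L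
    obtain ⟨v, hv⟩ := exists_ne (0 : L)
    have : (⨆ c, eig L c) ≤ ⊥ := iSup_le fun c w hw => by
      by_contra h0
      obtain ⟨k, rfl⟩ := hL.wt c w hw h0
      exact h0 (hne k w hw)
    exact hv (this (hL.top v))
  obtain ⟨w, hw, hw0⟩ := Nat.find_spec hex
  set k := Nat.find hex with hk
  have up (n : ℤ) (hn : 0 < n) (u : U) (hu : u ∈ gr n) : u • w = 0 := by
    by_contra h0
    have h1 := gr_smul_mem hu hw
    obtain ⟨l, hl⟩ := hL.wt _ _ h1 h0
    have h2 : k ≤ l := Nat.find_min' hex ⟨_, hl ▸ h1, h0⟩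
    have h3 : (((l : ℤ) - k + n : ℤ) : ℂ) = 0 := by push_cast; linear_combination hl
    rw [Int.cast_eq_zero] at h3
    lia
  let f := vermaLift w (up 2 (by lia) E E_mem_gr) (up 1 (by lia) P P_mem_gr) hw (hL.zero w)
  have hf : f (hwVec _ 0) = w := vermaLift_hwVec ..
  have hs : Function.Surjective f := fun z => by
    obtain ⟨u, hu⟩ := exists_smul_eq_of_isSimpleModule hw0 z
    exact ⟨u • hwVec _ 0, by rw [map_smul, hf, hu]⟩
  have hne : LinearMap.ker f ≠ ⊤ := fun h => hw0 (by
    have : hwVec (a - k) 0 ∈ LinearMap.ker f := h ▸ Submodule.mem_top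
    rwa [LinearMap.mem_ker, hf] at this)
  have e := f.quotKerEquivOfSurjective hs
  have hco : IsCoatom (LinearMap.ker f) := by
    rw [← isSimpleModule_iff_isCoatom]
    exact IsSimpleModule.congr e
  have hker : LinearMap.ker f = vermaRad (a - k) 0 := by
    by_contra h
    exact vermaRad_ne_top (hco.2 _ (lt_of_le_of_ne (le_vermaRad hne) h))
  exact ⟨k, ⟨e.symm.trans (Submodule.quotEquivOfEq _ _ hker)⟩⟩

theorem eq_of_verma_equiv {b : ℂ} {j k : ℕ} (e : Verma (b - j) 0 ≃ₗ[U] Verma (b - k) 0) :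
    j = k := by
  have key {j k : ℕ} (e : Verma (b - j) 0 ≃ₗ[U] Verma (b - k) 0) : k ≤ j := by
    have h := tw_verma (b - k) 0
    rw [Nat.cast_zero, sub_zero] at h
    obtain ⟨l, hl⟩ := h.wt _ _ (map_mem_eig e.toLinearMap hwVec_mem_eig) fun h0 => by
      have : hwVec (b - j) 0 = 0 := e.injective (h0.trans (map_zero e).symm)
      have h1 := topCoord_hwVec (a := b - j)
      rw [this, map_zero] at h1
      exact zero_ne_one h1
    have h3 : (((k : ℤ) + l - j : ℤ) : ℂ) = 0 := by push_cast; linear_combination hl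
    rw [Int.cast_eq_zero] at h3
    lia
  exact le_antisymm (key e.symm) (key e)

end Simple

section Trunc

theorem isScalarTower_cmod (M : Type) [AddCommGroup M] [Module U M] :
    letI := cmod M
    IsScalarTower ℂ U M :=
  letI := cmod M
  ⟨fun c u v => by rw [Algebra.smul_def, mul_smul]; rfl⟩

theorem TW.of_inTrunc {a : ℂ} {M : ModuleCat.{0} U} [Module ℂ M] [IsScalarTower ℂ U M]
    (h : InTrunc a M) : TW a M := by
  obtain ⟨⟨⟨-, h1, -⟩, h2⟩, h3⟩ := h
  have hZ (v : M) : Z • v = 0 := by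
    refine AddSubgroup.closure_induction (p := fun v _ => Z • v = 0) ?_ (smul_zero _)
      (fun x y _ _ hx hy => by rw [smul_add, hx, hy, add_zero])
      (fun x _ hx => by rw [smul_neg, hx, neg_zero]) (h1 v)
    rintro w ⟨hh, zz, hw⟩
    by_cases h0 : w = 0
    · rw [h0, smul_zero]
    · rw [hw.2, (h2 w hh zz h0 hw).1, sc_smul, zero_smul]
  refine ⟨hZ, fun v => ?_, fun c v hv h0 => ?_⟩
  · have : AddSubgroup.closure {w : M | ∃ hh zz : ℂ, IsWeightVec hh zz w} ≤
        (⨆ c, eig M c).toAddSubgroup := by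
      refine (AddSubgroup.closure_le _).2 ?_
      rintro w ⟨hh, zz, hw⟩
      refine Submodule.mem_iSup_of_mem (p := eig M) hh (mem_eig.2 ?_)
      rw [hw.1, sc_smul]
    exact this (h1 v)
  · have hw : IsWeightVec c 0 v :=
      ⟨by rw [mem_eig.1 hv, sc_smul], by rw [hZ, sc_smul, zero_smul]⟩
    obtain ⟨n, rfl⟩ := (h2 v c 0 h0 hw).2
    by_cases hn : 1 ≤ n
    · obtain ⟨k, rfl⟩ := Int.eq_ofNat_of_zero_le (by lia : 0 ≤ n)
      exact absurd (h3 v k (by lia) (by simpa using hw)) h0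
    · obtain ⟨k, hk⟩ := Int.eq_ofNat_of_zero_le (by lia : 0 ≤ -n)
      refine ⟨k, ?_⟩
      rw [← Int.cast_natCast (R := ℂ) k, ← hk]
      push_cast; ring

variable {M : Type} [AddCommGroup M] [Module U M] [Module ℂ M] [IsScalarTower ℂ U M]

theorem E_pow_mul_P_pow_mem_gr (m n : ℕ) : E ^ m * P ^ n ∈ gr (2 * m + n) := by
  have hF : E ^ m ∈ gr (2 * m) := by
    induction m with
    | zero => simp [mem_gr]
    | succ m ih =>
      rw [pow_succ]
      convert mul_mem_gr ih E_mem_gr using 2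
      push_cast; ring
  have hQ : P ^ n ∈ gr n := by
    induction n with
    | zero => simp [mem_gr]
    | succ n ih =>
      rw [pow_succ]
      convert mul_mem_gr ih P_mem_gr using 2
      push_cast; ring
  convert mul_mem_gr hF hQ using 2

theorem TW.locally_finite {a : ℂ} (h : TW a M) (v : M) :
    ∃ W : Submodule ℂ M, FiniteDimensional ℂ W ∧ ∀ u ∈ nPlus, u • v ∈ W := by
  refine Submodule.iSup_induction (eig M)
    (motive := fun v => ∃ W : Submodule ℂ M, FiniteDimensional ℂ W ∧ ∀ u ∈ nPlus, u • v ∈ W)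
    (h.top v) ?_ ⟨⊥, inferInstance, fun u _ => by rw [smul_zero]; exact zero_mem _⟩ ?_
  · intro c v hv
    by_cases h0 : v = 0
    · exact ⟨⊥, inferInstance, fun u _ => by rw [h0, smul_zero]; exact zero_mem _⟩
    obtain ⟨k, rfl⟩ := h.wt c v hv h0
    let f : ℕ × ℕ → M := fun x => (E ^ x.1 * P ^ x.2) • v
    have hf (x : ℕ × ℕ) (hx : k < 2 * x.1 + x.2) : f x = 0 := by
      refine h.tl.wt (2 * x.1 + x.2 - k) _ (by lia) ?_
      have h1 := gr_smul_mem (E_pow_mul_P_pow_mem_gr x.1 x.2) hv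
      rw [Nat.cast_sub hx.le]
      convert h1 using 2
      push_cast; ring
    let W := Submodule.span ℂ (Set.range f)
    have hle : Set.range f ⊆ insert 0 (f '' (Set.Iic k ×ˢ Set.Iic k)) := by
      rintro _ ⟨x, rfl⟩
      by_cases hx : k < 2 * x.1 + x.2
      · exact Or.inl (hf x hx)
      · exact Or.inr ⟨x, by simp only [Set.mem_prod, Set.mem_Iic]; lia, rfl⟩
    have hfin : (Set.range f).Finite :=
      ((((Set.finite_Iic k).prod (Set.finite_Iic k)).image f).insert 0).subset hle
    refine ⟨W, FiniteDimensional.span_of_finite ℂ hfin, fun u hu => ?_⟩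
    let S : Subalgebra ℂ U :=
      { carrier := {u | ∀ y ∈ W, u • y ∈ W}
        mul_mem' := fun {a b} ha hb y hy => by rw [mul_smul]; exact ha _ (hb _ hy)
        add_mem' := fun {a b} ha hb y hy => by rw [add_smul]; exact add_mem (ha _ hy) (hb _ hy)
        algebraMap_mem' := fun r y hy => by rw [algebraMap_smul]; exact W.smul_mem r hy }
    have key (u : U) (h : ∀ x, u • f x ∈ W) : u ∈ S := by
      have : W ≤ W.comap (act _ u) := by
        refine Submodule.span_le.2 ?_
        rintro _ ⟨x, rfl⟩
        exact h x
      exact this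
    have hS : nPlus ≤ S := by
      refine Algebra.adjoin_le ?_
      rintro _ (rfl | rfl)
      · refine key _ fun x => Submodule.subset_span ⟨(x.1 + 1, x.2), ?_⟩
        simp only [f, ← mul_smul, ← mul_assoc, pow_succ']
      · refine key _ fun x => Submodule.subset_span ⟨(x.1, x.2 + 1), ?_⟩
        have hc : Commute P (E ^ x.1) := Commute.pow_right (E_mul_P.symm : Commute P E) x.1
        simp only [f, ← mul_smul, ← mul_assoc, pow_succ']
        rw [hc.eq]
    exact hS hu v (Submodule.subset_span ⟨(0, 0), by simp [f]⟩)
  · rintro x y ⟨V, hV, hx⟩ ⟨W, hW, hy⟩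
    exact ⟨V ⊔ W, inferInstance, fun u hu => by
      rw [smul_add]
      exact add_mem (Submodule.mem_sup_left (hx u hu)) (Submodule.mem_sup_right (hy u hu))⟩

theorem cmod_eq : cmod M = ‹Module ℂ M› := by
  refine Module.ext' _ _ fun c v => ?_
  exact algebraMap_smul U c v

theorem TW.inTrunc {a : ℂ} (h : TW a M) [hfin : Module.Finite U M] :
    InTrunc a (ModuleCat.of U M) := by
  refine ⟨⟨⟨hfin, fun v => ?_, ?_⟩, fun v hh zz h0 hv => ?_⟩, fun v k hk hv => ?_⟩
  · refine Submodule.iSup_induction (eig M)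
      (motive := fun v => v ∈ AddSubgroup.closure {w : M | ∃ hh zz : ℂ, IsWeightVec hh zz w})
      (h.top v) (fun c w hw => AddSubgroup.subset_closure ⟨c, 0, ?_⟩) (zero_mem _)
      fun x y hx hy => add_mem hx hy
    exact ⟨by rw [mem_eig.1 hw, sc_smul], by rw [h.zero, sc_smul, zero_smul]⟩
  · have hc : cmod M = _ := cmod_eq
    have hl := h.locally_finite
    clear h
    subst hc
    exact hl
  · have h1 : (v : M) ∈ eig M hh := mem_eig.2 (hv.1.trans (sc_smul (M := M) hh v))
    obtain ⟨k, rfl⟩ := h.wt hh v h1 h0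
    have h2 : zz • (v : M) = 0 := (sc_smul (M := M) zz v).symm.trans (hv.2.symm.trans (h.zero v))
    exact ⟨(smul_eq_zero.1 h2).resolve_right h0, -k, by push_cast; ring⟩
  · exact h.tl.wt k v hk (mem_eig.2 (hv.1.trans (sc_smul (M := M) _ v)))

end Trunc

section Fitting

variable {M : Type} [AddCommGroup M] [Module U M] [Module ℂ M] [IsScalarTower ℂ U M] {a : ℂ}

theorem TW.exists_mem_eig_ne_zero (h : TW a M) {N : Submodule U M} (hN : N ≠ ⊥) :
    ∃ c, ∃ v ∈ eig M c, v ∈ N ∧ v ≠ 0 := by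
  by_contra! hne
  refine hN ((Submodule.eq_bot_iff N).2 fun y hy => ?_)
  have h1 : (⨆ c, eig N c) ≤ ⊥ := iSup_le fun c w hw =>
    Subtype.ext (hne c w (map_mem_eig N.subtype hw) w.2)
  exact congr_arg Subtype.val ((Submodule.mem_bot _).1 (h1 ((h.submodule N).top ⟨y, hy⟩)))

theorem TW.isCompl_fitting (h : TW a M) (hfd : ∀ c, FiniteDimensional ℂ (eig M c))
    (φ : Module.End U M) :
    IsCompl (⨆ n : ℕ, LinearMap.ker (φ ^ n)) (⨅ n : ℕ, LinearMap.range (φ ^ n)) := by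
  let φc (c : ℂ) : Module.End ℂ (eig M c) :=
    (φ.restrictScalars ℂ).restrict fun v hv => map_mem_eig φ hv
  have hpow (c : ℂ) (n : ℕ) (v : eig M c) : ((φc c ^ n) v : M) = (φ ^ n) v := by
    induction n generalizing v with
    | zero => rfl
    | succ n ih => rw [pow_succ, pow_succ, Module.End.mul_apply, Module.End.mul_apply, ih]; rfl
  have hmono : Monotone fun n : ℕ => LinearMap.ker (φ ^ n) := by
    refine monotone_nat_of_le_succ fun n v hv => ?_
    rw [LinearMap.mem_ker] at *
    rw [pow_succ', Module.End.mul_apply, hv, map_zero]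
  have hc (c : ℂ) := (φc c).isCompl_iSup_ker_pow_iInf_range_pow
  constructor
  · rw [disjoint_iff]
    by_contra hne
    obtain ⟨c, v, hv, ⟨hK, hI⟩, h0⟩ := h.exists_mem_eig_ne_zero hne
    refine h0 (congr_arg Subtype.val (Submodule.disjoint_def.1 (hc c).disjoint ⟨v, hv⟩ ?_ ?_))
    · obtain ⟨n, hn⟩ := (Submodule.mem_iSup_of_directed _ hmono.directed_le).1 hK
      refine Submodule.mem_iSup_of_mem n (LinearMap.mem_ker.2 (Subtype.ext ?_))
      rw [hpow]
      exact hn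
    · refine Submodule.mem_iInf _ |>.2 fun n => ?_
      obtain ⟨z, rfl⟩ := (Submodule.mem_iInf _).1 hI n
      obtain ⟨y, hy, hyz⟩ := exists_mem_of_map_mem_eig ((φ ^ n).restrictScalars ℂ) (eig M) id
        Function.injective_id (fun c x hx => map_mem_eig (φ ^ n) hx) (h.top z) (i := c) hv
      exact ⟨⟨y, hy⟩, Subtype.ext ((hpow c n _).trans hyz)⟩
  · rw [codisjoint_iff, eq_top_iff]
    intro y _
    have hle : (⨆ c, eig M c) ≤ ((⨆ n : ℕ, LinearMap.ker (φ ^ n)) ⊔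
        (⨅ n : ℕ, LinearMap.range (φ ^ n))).restrictScalars ℂ := by
      refine iSup_le fun c v hv => ?_
      obtain ⟨k, hk, r, hr, hkr⟩ := Submodule.mem_sup.1
        ((hc c).codisjoint.eq_top ▸ Submodule.mem_top : (⟨v, hv⟩ : eig M c) ∈ _ ⊔ _)
      have e : v = k + r := congr_arg Subtype.val hkr.symm
      rw [e]
      refine Submodule.add_mem_sup ?_ ?_
      · have : (⨆ n : ℕ, LinearMap.ker (φc c ^ n)) ≤ ((⨆ n : ℕ,
            LinearMap.ker (φ ^ n)).restrictScalars ℂ).comap (eig M c).subtype := by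
          refine iSup_le fun n w hw => Submodule.mem_iSup_of_mem n (LinearMap.mem_ker.2 ?_)
          exact (hpow c n w).symm.trans (congr_arg Subtype.val hw)
        exact this hk
      · refine (Submodule.mem_iInf _).2 fun n => ?_
        obtain ⟨w, hw⟩ := (Submodule.mem_iInf _).1 hr n
        exact ⟨w, (hpow c n w).symm.trans (congr_arg Subtype.val hw)⟩
    exact hle (h.top y)

theorem TW.surjective_of_pow_ne_zero (h : TW a M) (hfd : ∀ c, FiniteDimensional ℂ (eig M c))
    (hind : ¬ ∃ N₁ N₂ : Submodule U M, IsCompl N₁ N₂ ∧ N₁ ≠ ⊥ ∧ N₂ ≠ ⊥) (φ : Module.End U M) {x : M}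
    (hx : ∀ n : ℕ, (φ ^ n) x ≠ 0) : Function.Surjective φ := by
  have hc := h.isCompl_fitting hfd φ
  have hmono : Monotone fun n : ℕ => LinearMap.ker (φ ^ n) := by
    refine monotone_nat_of_le_succ fun n v hv => ?_
    rw [LinearMap.mem_ker] at *
    rw [pow_succ', Module.End.mul_apply, hv, map_zero]
  by_cases hI : (⨅ n : ℕ, LinearMap.range (φ ^ n)) = ⊥
  · rw [hI] at hc
    replace hc := eq_top_of_isCompl_bot hc
    obtain ⟨n, hn⟩ := (Submodule.mem_iSup_of_directed _ hmono.directed_le).1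
      (hc ▸ Submodule.mem_top : x ∈ _)
    exact absurd hn (hx n)
  · by_cases hK : (⨆ n : ℕ, LinearMap.ker (φ ^ n)) = ⊥
    · rw [hK] at hc
      replace hc := eq_top_of_bot_isCompl hc
      refine LinearMap.range_eq_top.1 (eq_top_iff.2 (hc ▸ ?_))
      exact (iInf_le _ 1).trans (by rw [pow_one])
    · exact absurd ⟨_, _, hc, hK, hI⟩ hind

end Fitting

section Proj

variable {M : Type} [AddCommGroup M] [Module U M] [Module ℂ M] [IsScalarTower ℂ U M] {a : ℂ} {i : ℕ}

theorem TW.top_of_not_le_ker {S : Type} [AddCommGroup S] [Module U S] [Module ℂ S]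
    [IsScalarTower ℂ U S] [IsSimpleModule U S] (hS : TW a S)
    (h : TW a M) (hfd : ∀ c, FiniteDimensional ℂ (eig M c))
    (hind : ¬ ∃ N₁ N₂ : Submodule U M, IsCompl N₁ N₂ ∧ N₁ ≠ ⊥ ∧ N₂ ≠ ⊥)
    (hproj : ProjInTrunc a (ModuleCat.of U M)) (π : M →ₗ[U] S)
    {N : Submodule U M} (hN : ¬ N ≤ LinearMap.ker π) : N = ⊤ := by
  obtain ⟨y, hy, hy0⟩ := Set.not_subset.1 hN
  let N' := Submodule.span U {y}
  have hN' : N' ≤ N := (Submodule.span_singleton_le_iff_mem _ _).2 hy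
  have : Module.Finite U N' := Module.Finite.span_singleton U y
  have hyN : y ∈ N' := Submodule.mem_span_singleton_self y
  let g : N' →ₗ[U] S := π ∘ₗ N'.subtype
  have hg : Function.Surjective g := fun z => by
    obtain ⟨u, hu⟩ := exists_smul_eq_of_isSimpleModule (y := π y) hy0 z
    exact ⟨u • ⟨y, hyN⟩, (map_smul g u _).trans hu⟩
  obtain ⟨f, hf⟩ := hproj (ModuleCat.of U N') (ModuleCat.of U S) (h.submodule N').inTrunc
    hS.inTrunc g hg π
  let φ : Module.End U M := N'.subtype ∘ₗ f
  have hφ (v : M) : π (φ v) = π v := LinearMap.congr_fun hf v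
  have hpow (n : ℕ) : π ((φ ^ n) y) = π y := by
    induction n with
    | zero => rfl
    | succ n ih => rw [pow_succ', Module.End.mul_apply, hφ, ih]
  have hs := h.surjective_of_pow_ne_zero hfd hind φ (x := y) fun n h0 => hy0 (by
    change π y = 0
    rw [← hpow n, h0, map_zero])
  refine eq_top_iff.2 fun v _ => hN' ?_
  obtain ⟨w, rfl⟩ := hs v
  exact (f w).2

end Proj

section Universal

/-- The conditions on a left ideal for the quotient to be generated by a vector of weight `λ - i`
and to have no weights in `λ + ℕ_{>0}`. -/
def UnivCond (a : ℂ) (i : ℕ) (J : Submodule U U) : Prop :=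
  H - sc (a - i) ∈ J ∧ Z ∈ J ∧ ∀ (k : ℕ) (u : U), 1 ≤ k → (H - sc (a + k)) * u ∈ J → u ∈ J

/-- The smallest left ideal satisfying `UnivCond`. -/
def univIdeal (a : ℂ) (i : ℕ) : Submodule U U := sInf {J | UnivCond a i J}

theorem univCond_univIdeal (a : ℂ) (i : ℕ) : UnivCond a i (univIdeal a i) := by
  simp only [univIdeal, UnivCond, Submodule.mem_sInf]
  exact ⟨fun J hJ => hJ.1, fun J hJ => hJ.2.1, fun k u hk h J hJ => hJ.2.2 k u hk (h J hJ)⟩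

/-- The module representing the weight space functor of weight `λ - i` on the truncated category. -/
abbrev Univ (a : ℂ) (i : ℕ) : Type := U ⧸ univIdeal a i

/-- The generator of the universal module. -/
def univVec (a : ℂ) (i : ℕ) : Univ a i := Submodule.Quotient.mk 1

variable {a : ℂ} {i : ℕ}

theorem smul_univVec (u : U) : u • univVec a i = Submodule.Quotient.mk u := by
  rw [univVec, ← Submodule.Quotient.mk_smul, smul_eq_mul, mul_one]

theorem univVec_mem_eig : univVec a i ∈ eig (Univ a i) (a - i) := by
  rw [mem_eig, ← sub_eq_zero, ← sc_smul, ← sub_smul, smul_univVec, Submodule.Quotient.mk_eq_zero]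
  exact (univCond_univIdeal a i).1

theorem exists_smul_univVec (y : Univ a i) : ∃ u : U, u • univVec a i = y := by
  obtain ⟨u, rfl⟩ := Submodule.Quotient.mk_surjective _ y
  exact ⟨u, smul_univVec u⟩

theorem tw_univ : TW a (Univ a i) := by
  refine TL.tw_of_cyclic ⟨fun v => ?_, fun k v hk hv => ?_⟩ univVec_mem_eig exists_smul_univVec
  · obtain ⟨u, rfl⟩ := exists_smul_univVec v
    rw [← mul_smul, Z_mul, smul_univVec, Submodule.Quotient.mk_eq_zero]
    exact Submodule.smul_mem _ u (univCond_univIdeal a i).2.1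
  · obtain ⟨u, rfl⟩ := exists_smul_univVec v
    rw [mem_eig, ← sub_eq_zero, ← sc_smul, ← sub_smul, ← mul_smul, smul_univVec,
      Submodule.Quotient.mk_eq_zero] at hv
    rw [smul_univVec, Submodule.Quotient.mk_eq_zero]
    exact (univCond_univIdeal a i).2.2 k u hk hv

variable {N : Type} [AddCommGroup N] [Module U N] [Module ℂ N] [IsScalarTower ℂ U N]

theorem TL.exists_hom_univ (h : TL a N) {m : N} (hm : m ∈ eig N (a - i)) :
    ∃ f : Univ a i →ₗ[U] N, f (univVec a i) = m := by
  have hle : univIdeal a i ≤ LinearMap.ker (LinearMap.toSpanSingleton U N m) := by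
    refine sInf_le ⟨?_, h.zero m, fun k u hk hu => ?_⟩
    · change (H - sc (a - i)) • m = 0
      rw [sub_smul, sc_smul, mem_eig.1 hm, sub_self]
    · change ((H - sc (a + k)) * u) • m = 0 at hu
      rw [mul_smul, sub_smul, sc_smul, sub_eq_zero] at hu
      exact h.wt k _ hk (mem_eig.2 hu)
  exact ⟨Submodule.liftQ _ _ hle, one_smul U m⟩

variable {M : Type} [AddCommGroup M] [Module U M] [Module ℂ M] [IsScalarTower ℂ U M]

/-- A projective object of the truncated category generated by a weight vector represents
the image of an idempotent on weight spaces. -/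
theorem TW.exists_idempotent (h : TW a M) (hproj : ProjInTrunc a (ModuleCat.of U M))
    {x : M} (hx : x ∈ eig M (a - i)) (hgen : ∀ y : M, ∃ u : U, u • x = y) :
    ∃ ε ∈ gr 0, ε • x = x ∧ ∀ (N : Type) [AddCommGroup N] [Module U N] [Module ℂ N]
      [IsScalarTower ℂ U N], TL a N → ∀ m ∈ eig N (a - i), ∃ φ : M →ₗ[U] N, φ x = ε • m := by
  obtain ⟨ρ, hρ⟩ := h.tl.exists_hom_univ hx
  have hs : Function.Surjective ρ := fun y => by
    obtain ⟨u, rfl⟩ := hgen y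
    exact ⟨u • univVec a i, by rw [map_smul, hρ]⟩
  have : Module.Finite U M := Module.Finite.of_surjective ρ hs
  obtain ⟨s, hs⟩ := hproj (ModuleCat.of U (Univ a i)) (ModuleCat.of U M) tw_univ.inTrunc h.inTrunc
    ρ hs LinearMap.id
  replace hs (y : M) : ρ (s y) = y := LinearMap.congr_fun hs y
  let s' : M →ₗ[U] Univ a i := s
  obtain ⟨u, hu⟩ := exists_smul_univVec (s' x)
  obtain ⟨ε, hε, hεx⟩ := exists_gr_smul_eq (n := 0) (by simp) univVec_mem_eig
    (hu ▸ map_mem_eig s' hx : u • univVec a i ∈ eig (Univ a i) (a - i))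
  rw [hu] at hεx
  refine ⟨ε, hε, ?_, fun N _ _ _ _ hN m hm => ?_⟩
  · have := hs x
    change ρ (s' x) = x at this
    rwa [← hεx, map_smul, hρ] at this
  · obtain ⟨f, hf⟩ := hN.exists_hom_univ hm
    exact ⟨f ∘ₗ s', by rw [LinearMap.comp_apply, ← hεx, map_smul, hf]⟩

end Universal

section Idempotent

/-- An element of `U` of degree zero which acts on the weight spaces of weight `λ - i` as an
idempotent that detects the simple module `L(λ - i)`. -/
structure MultIdem (a : ℂ) (i : ℕ) (e : U) : Prop where
  mem : e ∈ gr 0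
  idem : ∀ (N : Type) [AddCommGroup N] [Module U N] [Module ℂ N] [IsScalarTower ℂ U N],
    TW a N → ∀ m ∈ eig N (a - i), e • e • m = e • m
  simple : e • simpleVec (a - i) = simpleVec (a - i)
  equiv : ∀ (L : Type) [AddCommGroup L] [Module U L] [Module ℂ L] [IsScalarTower ℂ U L]
    [IsSimpleModule U L], TW a L → ∀ m ∈ eig L (a - i), e • m = m → m ≠ 0 →
      Nonempty (L ≃ₗ[U] SimpleHW (a - i) 0)

variable {a : ℂ} {i : ℕ}

theorem gr_zero_smul_mem {M : Type} [AddCommGroup M] [Module U M] [Module ℂ M]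
    [IsScalarTower ℂ U M] {e : U} (he : e ∈ gr 0) {c : ℂ} {v : M} (hv : v ∈ eig M c) :
    e • v ∈ eig M c := by
  have := gr_smul_mem he hv
  rwa [Int.cast_zero, add_zero] at this

theorem anti_mem_gr_zero {e : U} (he : e ∈ gr 0) : anti e ∈ gr 0 := by
  have := anti_mem_gr he
  rwa [neg_zero] at this

theorem equiv_of_hom_ne_zero {M S T : Type} [AddCommGroup M] [Module U M] [AddCommGroup S]
    [Module U S] [IsSimpleModule U S]
    [AddCommGroup T] [Module U T] [IsSimpleModule U T] (π : M →ₗ[U] T)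
    (hπ : Function.Surjective π) (hmax : ∀ N : Submodule U M, ¬ N ≤ LinearMap.ker π → N = ⊤)
    (φ : M →ₗ[U] S) (hφ : φ ≠ 0) : Nonempty (S ≃ₗ[U] T) := by
  have hs : Function.Surjective φ := LinearMap.surjective_of_ne_zero hφ
  have e := φ.quotKerEquivOfSurjective hs
  have e' := π.quotKerEquivOfSurjective hπ
  have hco : IsCoatom (LinearMap.ker φ) := by
    rw [← isSimpleModule_iff_isCoatom]
    exact IsSimpleModule.congr e
  have hco' : IsCoatom (LinearMap.ker π) := by
    rw [← isSimpleModule_iff_isCoatom]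
    exact IsSimpleModule.congr e'
  have hle : LinearMap.ker φ ≤ LinearMap.ker π := by
    by_contra h
    exact hco.1 (hmax _ h)
  have hker : LinearMap.ker φ = LinearMap.ker π := by
    by_contra h
    exact hco'.1 (hco.2 _ (lt_of_le_of_ne hle h))
  exact ⟨e.symm.trans ((Submodule.quotEquivOfEq _ _ hker).trans e')⟩

theorem exists_simple_smul_ne_zero {ε : U} {k : ℕ}
    {m : SimpleHW (a - k) 0} (hm : m ∈ eig _ (a - i)) (hm1 : anti ε • m = m) (h0 : m ≠ 0) :
    ∃ y ∈ eig (SimpleHW (a - k) 0) (a - i), ε • y ≠ 0 := by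
  obtain ⟨u₂, rfl⟩ := exists_smul_simpleVec m
  obtain ⟨u', hu'⟩ := exists_smul_eq_of_isSimpleModule h0 (simpleVec (a - k))
  have hs : u' • u₂ • simpleVec (a - k) ∈ eig (SimpleHW (a - k) 0) (a - k) := by
    rw [hu']
    exact simpleVec_mem_eig
  obtain ⟨u, hu, huu⟩ := exists_gr_smul_eq (n := i - k) (by push_cast; ring) hm hs
  rw [hu'] at huu
  have hgr : anti u • simpleVec (a - k) ∈ eig (SimpleHW (a - k) 0) (a - i) := by
    have := gr_smul_mem (anti_mem_gr hu) (simpleVec_mem_eig (a := a - k))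
    convert this using 2
    push_cast; ring
  refine ⟨_, hgr, fun hz => ?_⟩
  have h1 : (u * anti ε * u₂) • simpleVec (a - k) = (1 : U) • simpleVec (a - k) := by
    rw [mul_smul, mul_smul, hm1, huu, one_smul]
  have h2 := topCoord_smul_eq_of_smul_simpleVec_eq h1 1
  rw [one_mul, one_mul, one_smul, topCoord_hwVec, ← topCoord_anti_smul, anti_mul, anti_mul,
    anti_anti] at h2
  have h3 : (ε * anti u) • simpleVec (a - k) = (0 : U) • simpleVec (a - k) := by
    rw [mul_smul, hz, zero_smul]
  have h4 := topCoord_smul_eq_of_smul_simpleVec_eq h3 (anti u₂)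
  rw [mul_zero, zero_smul, map_zero, h2] at h4
  exact one_ne_zero h4

theorem multIdem_anti {M : Type} [AddCommGroup M] [Module U M] {x : M}
    (π : M →ₗ[U] SimpleHW (a - i) 0) (hπ : Function.Surjective π) (hπx : π x = simpleVec (a - i))
    (hmax : ∀ N : Submodule U M, ¬ N ≤ LinearMap.ker π → N = ⊤)
    {ε : U} (hε : ε ∈ gr 0) (hεx : ε • x = x)
    (hεφ : ∀ (N : Type) [AddCommGroup N] [Module U N] [Module ℂ N]
      [IsScalarTower ℂ U N], TL a N → ∀ m ∈ eig N (a - i), ∃ φ : M →ₗ[U] N, φ x = ε • m) :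
    MultIdem a i (anti ε) := by
  have hidem (N : Type) [AddCommGroup N] [Module U N] [Module ℂ N] [IsScalarTower ℂ U N]
      (hN : TL a N) (m : N) (hm : m ∈ eig N (a - i)) : ε • ε • m = ε • m := by
    obtain ⟨φ, hφ⟩ := hεφ N hN m hm
    rw [← hφ, ← map_smul, hεx]
  refine ⟨anti_mem_gr_zero hε, fun N _ _ _ _ hN m hm => ?_, ?_, fun L _ _ _ _ _ hL m hm hm1 h0 => ?_⟩
  · have h1 := gr_zero_smul_mem (anti_mem_gr_zero hε) hm
    have h2 := gr_zero_smul_mem (anti_mem_gr_zero hε) h1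
    let v : eig N (a - i) := ⟨anti ε • anti ε • m - anti ε • m, sub_mem h2 h1⟩
    suffices hv : v = 0 from sub_eq_zero.1 (congr_arg Subtype.val hv)
    refine (Module.forall_dual_apply_eq_zero_iff ℂ v).1 fun ψ => ?_
    obtain ⟨g, hg, hgψ⟩ := exists_weight_functional hN.top (a - i) ψ
    rw [← hgψ]
    change g (anti ε • anti ε • m - anti ε • m) = 0
    rw [map_sub, sub_eq_zero, ← Tw.smul_apply ε g, ← Tw.smul_apply ε (ε • g),
      hidem (Tw N) hN.tl_tw g hg, Tw.smul_apply]
  · have h1 : ε • simpleVec (a - i) = (1 : U) • simpleVec (a - i) := by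
      rw [← hπx, ← map_smul, hεx, one_smul]
    obtain ⟨c, hc⟩ := exists_eq_smul_simpleVec
      (gr_zero_smul_mem (anti_mem_gr_zero hε) (simpleVec_mem_eig (a := a - i)))
    have h2 := topCoord_smul_eq_of_smul_simpleVec_eq h1 1
    rw [← sc_smul] at hc
    have h3 := topCoord_smul_eq_of_smul_simpleVec_eq hc 1
    rw [one_mul, one_mul, one_smul, topCoord_hwVec] at h2
    rw [one_mul, one_mul, topCoord_anti_smul, h2, sc_smul, map_smul, topCoord_hwVec, smul_eq_mul,
      mul_one] at h3
    rw [hc, ← h3, sc_smul, one_smul]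
  · obtain ⟨k, ⟨e⟩⟩ := exists_equiv_simpleHW hL
    obtain ⟨y, hy, hy0⟩ := exists_simple_smul_ne_zero (ε := ε) (i := i) (m := e m)
      (map_mem_eig e.toLinearMap hm) (by rw [← map_smul, hm1])
      (fun h => h0 (e.injective (h.trans (map_zero e).symm)))
    obtain ⟨φ, hφ⟩ := hεφ _ (tw_simpleHW a k).tl y hy
    obtain ⟨e'⟩ := equiv_of_hom_ne_zero π hπ hmax φ
      (fun h => hy0 (by rw [← hφ, h, LinearMap.zero_apply]))
    exact ⟨e.trans e'⟩

end Idempotent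

section SubQuot

variable {M : Type} [AddCommGroup M] [Module U M] {L : Type} [AddCommGroup L] [Module U L]

theorem exists_of_subQuot_equiv {A B : Submodule U M} (e : subQuot A B ≃ₗ[U] L) :
    ∃ g : B →ₗ[U] L, Function.Surjective g ∧ ∀ b : B, g b = 0 ↔ (b : M) ∈ A := by
  let e' : (B ⧸ Submodule.comap B.subtype A) ≃ₗ[U] L := e
  refine ⟨e'.toLinearMap ∘ₗ Submodule.mkQ _, ?_, fun b => ?_⟩
  · exact e'.surjective.comp (Submodule.mkQ_surjective _)
  · rw [LinearMap.comp_apply, LinearEquiv.coe_coe, e'.map_eq_zero_iff, Submodule.mkQ_apply,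
      Submodule.Quotient.mk_eq_zero]
    rfl

end SubQuot

section CompMult

variable {M : Type} [AddCommGroup M] [Module U M] [Module ℂ M] [IsScalarTower ℂ U M]
variable {a : ℂ} {i : ℕ} {e : U}

/-- The vectors of `h`-weight `b` fixed by `e`. -/
def fixedPart (b : ℂ) (e : U) (M : Type) [AddCommGroup M] [Module U M] [Module ℂ M]
    [IsScalarTower ℂ U M] : Submodule ℂ M :=
  eig M b ⊓ (act M e).eigenspace 1

theorem mem_fixedPart {b : ℂ} {m : M} : m ∈ fixedPart b e M ↔ m ∈ eig M b ∧ e • m = m := by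
  rw [fixedPart, Submodule.mem_inf, Module.End.mem_eigenspace_iff, one_smul, act_apply]

theorem MultIdem.smul_mem_fixedPart (he : MultIdem a i e) (h : TW a M) {m : M}
    (hm : m ∈ eig M (a - i)) : e • m ∈ fixedPart (a - i) e M :=
  mem_fixedPart.2 ⟨gr_zero_smul_mem he.mem hm, he.idem M h m hm⟩

/-- The fixed vectors in a submodule. -/
def fixedIn (b : ℂ) (e : U) (N : Submodule U M) : Submodule ℂ M :=
  fixedPart b e M ⊓ N.restrictScalars ℂ

theorem fixedIn_mono {b : ℂ} {N N' : Submodule U M} (h : N ≤ N') :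
    fixedIn b e N ≤ fixedIn b e N' := fun _ hm => ⟨hm.1, h hm.2⟩

theorem MultIdem.fixedIn_lt (he : MultIdem a i e) (h : TW a M) {A B : Submodule U M} (hAB : A ≤ B)
    (eq : subQuot A B ≃ₗ[U] SimpleHW (a - i) 0) :
    fixedIn (a - i) e A < fixedIn (a - i) e B := by
  refine lt_of_le_of_ne (fixedIn_mono hAB) fun heq => ?_
  obtain ⟨g, hg, hgA⟩ := exists_of_subQuot_equiv eq
  obtain ⟨b, hb, hbl⟩ := exists_eig_lift (h.submodule B).top g hg (simpleVec_mem_eig (a := a - i))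
  have h1 : ((e • b : B) : M) ∈ fixedIn (a - i) e B :=
    ⟨he.smul_mem_fixedPart h (map_mem_eig B.subtype hb), (e • b).2⟩
  rw [← heq] at h1
  have h2 := (hgA (e • b)).2 h1.2
  rw [map_smul, hbl, he.simple] at h2
  exact simpleVec_ne_zero h2

variable [FiniteDimensional ℂ (eig M (a - i))]

theorem finiteDimensional_fixedIn (N : Submodule U M) :
    FiniteDimensional ℂ (fixedIn (a - i) e N) :=
  Submodule.finiteDimensional_of_le (S₂ := eig M (a - i)) fun _ hm => (mem_fixedPart.1 hm.1).1

theorem MultIdem.le_of_hasLayers (he : MultIdem a i e) (h : TW a M) {n : ℕ}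
    (hL : HasLayers M (SimpleHW (a - i) 0) n) :
    n ≤ Module.finrank ℂ (fixedIn (a - i) e (⊤ : Submodule U M)) := by
  obtain ⟨A, B, hAB, hBA, heq⟩ := hL
  have hfd (N : Submodule U M) := finiteDimensional_fixedIn (a := a) (i := i) (e := e) N
  have key (k : ℕ) (hk : k < n) :
      k + 1 ≤ Module.finrank ℂ (fixedIn (a - i) e (B ⟨k, hk⟩)) := by
    induction k with
    | zero =>
      have := hfd (B ⟨0, hk⟩)
      exact Nat.succ_le_of_lt ((Nat.zero_le _).trans_lt
        (Submodule.finrank_lt_finrank_of_lt (he.fixedIn_lt h (hAB ⟨0, hk⟩) (heq _).some)))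
    | succ k ih =>
      have h1 := ih (by lia)
      have := hfd (B ⟨k + 1, hk⟩)
      have := hfd (A ⟨k + 1, hk⟩)
      have h2 := Submodule.finrank_lt_finrank_of_lt
        (he.fixedIn_lt h (hAB ⟨k + 1, hk⟩) (heq _).some)
      have h3 := Submodule.finrank_mono (fixedIn_mono (b := a - i) (e := e)
        (hBA ⟨k, by lia⟩ ⟨k + 1, hk⟩ (by simp [Fin.lt_def])))
      lia
  cases n with
  | zero => exact Nat.zero_le _
  | succ n =>
    have := hfd ⊤
    exact (key n (by lia)).trans (Submodule.finrank_mono (fixedIn_mono le_top))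

theorem MultIdem.exists_layer (he : MultIdem a i e) (h : TW a M) {N : Submodule U M}
    (hN : Module.finrank ℂ (fixedIn (a - i) e N) <
      Module.finrank ℂ (fixedIn (a - i) e (⊤ : Submodule U M))) :
    ∃ A B : Submodule U M, N ≤ A ∧ A ≤ B ∧ Nonempty (subQuot A B ≃ₗ[U] SimpleHW (a - i) 0) ∧
      Module.finrank ℂ (fixedIn (a - i) e B) ≤ Module.finrank ℂ (fixedIn (a - i) e N) + 1 := by
  classical
  have hfd (N : Submodule U M) := finiteDimensional_fixedIn (a := a) (i := i) (e := e) N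
  let V := fixedPart (a - i) e M
  let r (m : M) := Module.finrank ℂ (fixedIn (a - i) e (N ⊔ Submodule.span U {m}))
  have hex : ∃ d : ℕ, ∃ m ∈ V, m ∉ N ∧ r m = d := by
    by_contra! hne
    have : fixedIn (a - i) e N = fixedIn (a - i) e ⊤ :=
      le_antisymm (fixedIn_mono le_top) fun m hm => ⟨hm.1, by_contra fun h => hne _ m hm.1 h rfl⟩
    rw [this] at hN
    exact lt_irrefl _ hN
  obtain ⟨m, hmV, hmN, hmr⟩ := Nat.find_spec hex
  have hmin (m' : M) (h1 : m' ∈ V) (h2 : m' ∉ N) : r m ≤ r m' :=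
    hmr ▸ Nat.find_min' hex ⟨m', h1, h2, rfl⟩
  set B := N ⊔ Submodule.span U {m} with hB
  have hmB : m ∈ B := Submodule.mem_sup_right (Submodule.mem_span_singleton_self m)
  obtain ⟨A, hNA, hA⟩ := zorn_le_nonempty₀ {A : Submodule U M | A ≤ B ∧ m ∉ A}
    (fun c hc hch y hy => ⟨sSup c, ⟨sSup_le fun A hA => (hc hA).1, fun hm => by
      obtain ⟨A, hA, hmA⟩ := (Submodule.mem_sSup_of_directed ⟨y, hy⟩ hch.directedOn).1 hm
      exact (hc hA).2 hmA⟩, fun A hA => le_sSup hA⟩) N ⟨le_sup_left, hmN⟩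
  have hAB : A ≤ B := hA.prop.1
  have hmA : m ∉ A := hA.prop.2
  -- every submodule between `A` and `B` is one of the two
  have hco : IsCoatom (A.comap B.subtype) := by
    refine ⟨fun htop => hmA ?_, fun C hC => ?_⟩
    · exact (htop ▸ Submodule.mem_top : (⟨m, hmB⟩ : B) ∈ A.comap B.subtype)
    · by_cases hmC : m ∈ C.map B.subtype
      · have hle : B ≤ C.map B.subtype := by
          refine sup_le (fun y hy => ?_) ((Submodule.span_singleton_le_iff_mem _ _).2 hmC)
          exact ⟨⟨y, hAB (hNA hy)⟩, hC.le (hNA hy), rfl⟩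
        refine eq_top_iff.2 fun y _ => ?_
        obtain ⟨z, hz, hzy⟩ := hle y.2
        rwa [← Subtype.ext hzy]
      · have h1 : A ≤ C.map B.subtype := fun y hy => ⟨⟨y, hAB hy⟩, hC.le hy, rfl⟩
        have h2 := hA.le_of_ge ⟨Submodule.map_subtype_le _ _, hmC⟩ h1
        refine absurd (fun y hy => ?_) hC.not_ge
        exact h2 ⟨y, hy, rfl⟩
  have hsimple : IsSimpleModule U (B ⧸ A.comap B.subtype) := isSimpleModule_iff_isCoatom.2 hco
  have hm := mem_fixedPart.1 hmV
  let mB : B := ⟨m, hmB⟩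
  have hmBe : mB ∈ eig B (a - i) := of_map_mem_eig B.subtype B.injective_subtype hm.1
  have heB : e • mB = mB := Subtype.ext hm.2
  have hiso := he.equiv (B ⧸ A.comap B.subtype) ((h.submodule B).quotient _)
    (Submodule.mkQ _ mB) (map_mem_eig _ hmBe) (by rw [← map_smul, heB])
    (fun h0 => hmA ((Submodule.Quotient.mk_eq_zero (A.comap B.subtype)).1 h0 : mB ∈ A.comap B.subtype))
  refine ⟨A, B, hNA, hAB, hiso, ?_⟩
  have hAN : fixedIn (a - i) e A = fixedIn (a - i) e N := by
    refine le_antisymm (fun m' hm' => ⟨hm'.1, by_contra fun hn => ?_⟩) (fixedIn_mono hNA)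
    have h1 : N ⊔ Submodule.span U {m'} ≤ A :=
      sup_le hNA ((Submodule.span_singleton_le_iff_mem _ _).2 hm'.2)
    have h2 : fixedIn (a - i) e (N ⊔ Submodule.span U {m'}) < fixedIn (a - i) e B :=
      lt_of_le_of_ne (fixedIn_mono (h1.trans hAB)) fun heq =>
        hmA (h1 (heq ▸ (⟨hmV, hmB⟩ : m ∈ fixedIn (a - i) e B) :
          m ∈ fixedIn (a - i) e (N ⊔ Submodule.span U {m'})).2)
    have := hfd B
    exact (Submodule.finrank_lt_finrank_of_lt h2).not_ge (hmin m' hm'.1 hn)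
  rw [← hAN]
  obtain ⟨f⟩ := hiso
  have hle : fixedIn (a - i) e B ≤ fixedIn (a - i) e A ⊔ Submodule.span ℂ {m} := by
    intro m' hm'
    have hm1 := mem_fixedPart.1 hm'.1
    let g : B →ₗ[U] SimpleHW (a - i) 0 := f.toLinearMap ∘ₗ Submodule.mkQ _
    have hg (b : B) : g b = 0 ↔ (b : M) ∈ A := by
      rw [LinearMap.comp_apply, LinearEquiv.coe_coe, f.map_eq_zero_iff]
      exact Submodule.Quotient.mk_eq_zero _
    obtain ⟨c, hc⟩ := exists_eq_smul_simpleVec (map_mem_eig g hmBe)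
    obtain ⟨d, hd⟩ := exists_eq_smul_simpleVec (map_mem_eig g
      (of_map_mem_eig B.subtype B.injective_subtype hm1.1 : (⟨m', hm'.2⟩ : B) ∈ eig B (a - i)))
    have hc0 : c ≠ 0 := fun h0 => hmA ((hg mB).1 (by rw [hc, h0, zero_smul]))
    have hmem : m' - (d / c) • m ∈ A := by
      refine (hg (⟨m', hm'.2⟩ - (d / c) • mB)).1 ?_
      have h1 : g ((d / c) • mB) = (d / c) • g mB := g.map_smul_of_tower _ _
      rw [map_sub, h1, hc, hd, smul_smul, div_mul_cancel₀ _ hc0, sub_self]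
    rw [← sub_add_cancel m' ((d / c) • m)]
    exact Submodule.add_mem_sup ⟨sub_mem hm'.1 (Submodule.smul_mem _ _ hmV), hmem⟩
      (Submodule.smul_mem _ _ (Submodule.mem_span_singleton_self m))
  have := hfd A
  refine (Submodule.finrank_mono hle).trans ((Submodule.finrank_add_le_finrank_add_finrank _ _).trans ?_)
  exact Nat.add_le_add_left ((finrank_span_le_card ({m} : Set M)).trans (by simp)) _

theorem MultIdem.exists_layers (he : MultIdem a i e) (h : TW a M) (n : ℕ) (N : Submodule U M)
    (hN : Module.finrank ℂ (fixedIn (a - i) e N) + n ≤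
      Module.finrank ℂ (fixedIn (a - i) e (⊤ : Submodule U M))) :
    ∃ A B : Fin n → Submodule U M, (∀ k, N ≤ A k) ∧ (∀ k, A k ≤ B k) ∧
      (∀ k l : Fin n, k < l → B k ≤ A l) ∧
      ∀ k, Nonempty (subQuot (A k) (B k) ≃ₗ[U] SimpleHW (a - i) 0) := by
  induction n generalizing N with
  | zero => exact ⟨nofun, nofun, nofun, nofun, nofun, nofun⟩
  | succ n ih =>
    obtain ⟨A₀, B₀, hNA, hAB, hiso, hr⟩ := he.exists_layer h (N := N) (by lia)
    obtain ⟨A, B, h1, h2, h3, h4⟩ := ih B₀ (by lia)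
    refine ⟨Fin.cons A₀ A, Fin.cons B₀ B, ?_, ?_, ?_, ?_⟩
    · exact Fin.cases hNA fun k => hNA.trans (hAB.trans (h1 k))
    · exact Fin.cases hAB h2
    · refine fun k l hkl => ?_
      induction l using Fin.cases with
      | zero => exact absurd hkl (Fin.not_lt_zero k)
      | succ l =>
        induction k using Fin.cases with
        | zero => exact h1 l
        | succ k => exact h3 k l (Fin.succ_lt_succ_iff.1 hkl)
    · exact Fin.cases hiso h4

theorem MultIdem.compMult_eq (he : MultIdem a i e) (h : TW a M) :
    compMult M (SimpleHW (a - i) 0) = (Module.finrank ℂ (fixedPart (a - i) e M) : ℕ∞) := by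
  have htop : fixedIn (a - i) e (⊤ : Submodule U M) = fixedPart (a - i) e M :=
    le_antisymm (fun _ hm => hm.1) fun _ hm => ⟨hm, trivial⟩
  have hbot : fixedIn (a - i) e (⊥ : Submodule U M) = ⊥ :=
    (Submodule.eq_bot_iff _).2 fun _ hm => hm.2
  rw [← htop]
  refine le_antisymm (sSup_le ?_) (le_sSup ⟨_, ?_, rfl⟩)
  · rintro _ ⟨n, hn, rfl⟩
    exact_mod_cast he.le_of_hasLayers h hn
  · obtain ⟨A, B, -, hL⟩ := he.exists_layers h _ ⊥ (by rw [hbot, finrank_bot, zero_add])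
    exact ⟨A, B, hL⟩

end CompMult

section Coinv

/-- The functionals of weight `b` that vanish on the images of `f` and `q`. -/
def coinv (b : ℂ) (M : Type) [AddCommGroup M] [Module U M] [Module ℂ M] [IsScalarTower ℂ U M] :
    Submodule ℂ (Module.Dual ℂ M) where
  carrier := {ψ | ∀ v, ψ (F • v) = 0 ∧ ψ (Q • v) = 0 ∧ ψ (H • v) = b * ψ v}
  add_mem' {ψ χ} h h' v := by
    simp only [LinearMap.add_apply, h v, h' v, add_zero, mul_add, and_self]
  zero_mem' v := by simp
  smul_mem' c ψ h v := by
    simp only [LinearMap.smul_apply, h v, smul_eq_mul, mul_zero, true_and]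
    ring

variable {K M N : Type} [AddCommGroup K] [Module U K] [Module ℂ K] [IsScalarTower ℂ U K]
  [AddCommGroup M] [Module U M] [Module ℂ M] [IsScalarTower ℂ U M]
  [AddCommGroup N] [Module U N] [Module ℂ N] [IsScalarTower ℂ U N] {b : ℂ}

theorem mem_coinv {ψ : Module.Dual ℂ M} :
    ψ ∈ coinv b M ↔ ∀ v, ψ (F • v) = 0 ∧ ψ (Q • v) = 0 ∧ ψ (H • v) = b * ψ v := Iff.rfl

/-- A linear map commuting with the action of `f`, `q` and `h`. -/
def IsLowerLinear (f : M →ₗ[ℂ] N) : Prop :=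
  ∀ v, f (F • v) = F • f v ∧ f (Q • v) = Q • f v ∧ f (H • v) = H • f v

theorem isLowerLinear_restrictScalars (f : M →ₗ[U] N) : IsLowerLinear (f.restrictScalars ℂ) :=
  fun v => ⟨f.map_smul F v, f.map_smul Q v, f.map_smul H v⟩

/-- Precomposition with a linear map commuting with the action of `f`, `q` and `h`. -/
def coinvMap (b : ℂ) {f : M →ₗ[ℂ] N} (hf : IsLowerLinear f) : coinv b N →ₗ[ℂ] coinv b M :=
  f.dualMap.restrict fun ψ hψ v => by
    simp only [LinearMap.dualMap_apply, hf v, mem_coinv.1 hψ (f v), and_self]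

theorem coinvMap_apply {f : M →ₗ[ℂ] N} (hf : IsLowerLinear f) (ψ : coinv b N) (v : M) :
    (coinvMap b hf ψ : Module.Dual ℂ M) v = (ψ : Module.Dual ℂ N) (f v) := rfl

/-- Isomorphic modules have isomorphic spaces `coinv`. -/
def coinvEquiv (b : ℂ) (e : M ≃ₗ[U] N) : coinv b N ≃ₗ[ℂ] coinv b M :=
  LinearEquiv.ofLinearMap (coinvMap b (isLowerLinear_restrictScalars e.toLinearMap))
    (coinvMap b (isLowerLinear_restrictScalars e.symm.toLinearMap))
    (by ext ψ v; simp [coinvMap_apply]) (by ext ψ v; simp [coinvMap_apply])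

theorem exists_section_verma (hM : ∀ v : M, v ∈ ⨆ c, eig M c) (g : M →ₗ[U] Verma b 0)
    (hg : Function.Surjective g) :
    ∃ s : Verma b 0 →ₗ[ℂ] M, IsLowerLinear s ∧ ∀ y, g (s y) = y := by
  obtain ⟨w, hw, hwg⟩ := exists_eig_lift hM g hg hwVec_mem_eig
  let s : Verma b 0 →ₗ[ℂ] M := (vermaBasis b).constr ℂ fun x => (F ^ x.1 * Q ^ x.2) • w
  have hs (m n : ℕ) : s (vermaMon b (m, n)) = (F ^ m * Q ^ n) • w := by
    rw [← vermaBasis_apply]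
    exact (vermaBasis b).constr_basis ℂ _ _
  have hFQ : Commute Q F := F_mul_Q.symm
  have hF : s ∘ₗ act _ F = act _ F ∘ₗ s := (vermaBasis b).ext fun ⟨m, n⟩ => by
    simp only [LinearMap.comp_apply, vermaBasis_apply, act_apply, F_smul_vermaMon, hs, smul_smul]
    rw [pow_succ', mul_assoc]
  have hQ : s ∘ₗ act _ Q = act _ Q ∘ₗ s := (vermaBasis b).ext fun ⟨m, n⟩ => by
    simp only [LinearMap.comp_apply, vermaBasis_apply, act_apply, Q_smul_vermaMon, hs, smul_smul]
    rw [← mul_assoc, (hFQ.pow_right m).eq, mul_assoc, pow_succ']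
  have hH : s ∘ₗ act _ H = act _ H ∘ₗ s := (vermaBasis b).ext fun ⟨m, n⟩ => by
    simp only [LinearMap.comp_apply, vermaBasis_apply, act_apply, H_smul_vermaMon, hs, map_smul]
    rw [mem_eig.1 (gr_smul_mem (F_pow_mul_Q_pow_mem_gr m n) hw)]
    congr 1
    push_cast
    ring
  have hid : g.restrictScalars ℂ ∘ₗ s = LinearMap.id := (vermaBasis b).ext fun ⟨m, n⟩ => by
    simp only [LinearMap.comp_apply, vermaBasis_apply, hs, LinearMap.id_apply,
      LinearMap.restrictScalars_apply, map_smul, hwg]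
    rfl
  exact ⟨s, fun v => ⟨LinearMap.congr_fun hF v, LinearMap.congr_fun hQ v, LinearMap.congr_fun hH v⟩,
    LinearMap.congr_fun hid⟩

theorem exists_retraction {b' : ℂ} (g : M →ₗ[U] Verma b' 0) {s : Verma b' 0 →ₗ[ℂ] M}
    (hs : IsLowerLinear s) (hgs : ∀ y, g (s y) = y) (f : K →ₗ[U] M) (hf : Function.Injective f)
    (hfg : ∀ m, g m = 0 ↔ m ∈ LinearMap.range f) :
    ∃ r : M →ₗ[ℂ] K, IsLowerLinear r ∧ ∀ m, f (r m) = m - s (g m) := by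
  have hmem (m : M) : m - s (g m) ∈ LinearMap.range f :=
    (hfg _).1 (by rw [map_sub, hgs, sub_self])
  choose r hr using hmem
  refine ⟨⟨⟨r, fun m m' => hf ?_⟩, fun c m => hf ?_⟩, fun m => ⟨hf ?_, hf ?_, hf ?_⟩, hr⟩
  · simp only [map_add, hr]
    abel
  · simp only [RingHom.id_apply, LinearMap.map_smul_of_tower, hr, smul_sub]
  all_goals
    change f (r _) = f (_ • r m)
    simp only [hr, map_smul, hs (g m), smul_sub]

theorem coinv_extension {b' : ℂ} (hM : ∀ v : M, v ∈ ⨆ c, eig M c) (g : M →ₗ[U] Verma b' 0)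
    (hg : Function.Surjective g) (f : K →ₗ[U] M) (hf : Function.Injective f)
    (hfg : ∀ m, g m = 0 ↔ m ∈ LinearMap.range f) :
    Nonempty (coinv b M ≃ₗ[ℂ] coinv b K × coinv b (Verma b' 0)) := by
  obtain ⟨s, hs, hgs⟩ := exists_section_verma hM g hg
  obtain ⟨r, hr, hrs⟩ := exists_retraction g hs hgs f hf hfg
  have hgf (k : K) : g (f k) = 0 := (hfg _).2 ⟨k, rfl⟩
  have hrf (k : K) : r (f k) = k := hf (by rw [hrs, hgf, map_zero, sub_zero])
  have hr_s (y : Verma b' 0) : r (s y) = 0 := hf (by rw [hrs, hgs, sub_self, map_zero])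
  have hf' := isLowerLinear_restrictScalars f
  have hg' := isLowerLinear_restrictScalars g
  refine ⟨LinearEquiv.ofLinearMap ((coinvMap b hf').prod (coinvMap b hs))
    ((coinvMap b hr).coprod (coinvMap b hg')) ?_ ?_⟩
  · refine LinearMap.ext fun ⟨α, β⟩ => Prod.ext (Subtype.ext (LinearMap.ext fun k => ?_))
      (Subtype.ext (LinearMap.ext fun y => ?_))
    · change (α : Module.Dual ℂ K) (r (f k)) + (β : Module.Dual ℂ (Verma b' 0)) (g (f k)) = α.1 k
      rw [hrf, hgf, map_zero, add_zero]
    · change (α : Module.Dual ℂ K) (r (s y)) + (β : Module.Dual ℂ (Verma b' 0)) (g (s y)) = β.1 y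
      rw [hr_s, hgs, map_zero, zero_add]
  · refine LinearMap.ext fun ψ => Subtype.ext (LinearMap.ext fun v => ?_)
    change (ψ : Module.Dual ℂ M) (f (r v)) + (ψ : Module.Dual ℂ M) (s (g v)) = ψ.1 v
    rw [← map_add, hrs, sub_add_cancel]

theorem finiteDimensional_eig_of_extension {c b' : ℂ} (g : M →ₗ[U] Verma b' 0)
    (f : K →ₗ[U] M) (hf : Function.Injective f)
    (hfg : ∀ m, g m = 0 ↔ m ∈ LinearMap.range f) [FiniteDimensional ℂ (eig K c)] :
    FiniteDimensional ℂ (eig M c) := by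
  have := finiteDimensional_eig_verma (a := b') c
  let g' : eig M c →ₗ[ℂ] eig (Verma b' 0) c :=
    (g.restrictScalars ℂ).restrict fun _ hm => map_mem_eig g hm
  let f' : eig K c →ₗ[ℂ] eig M c :=
    (f.restrictScalars ℂ).restrict fun _ hm => map_mem_eig f hm
  have : FiniteDimensional ℂ (LinearMap.ker g') := by
    refine Submodule.finiteDimensional_of_le (S₂ := LinearMap.range f') fun m hm => ?_
    obtain ⟨k, hk⟩ := (hfg m).1 (congrArg Subtype.val hm)
    exact ⟨⟨k, of_map_mem_eig f hf (hk ▸ m.2)⟩, Subtype.ext hk⟩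
  have := Module.Finite.equiv g'.quotKerEquivRange.symm
  exact Module.Finite.of_submodule_quotient (LinearMap.ker g')

theorem mem_coinv_verma {b' : ℂ} {ψ : Module.Dual ℂ (Verma b' 0)} (hψ : ψ ∈ coinv b (Verma b' 0)) :
    ψ = ψ (hwVec b' 0) • topCoord b' := by
  refine (vermaBasis b').ext fun ⟨m, n⟩ => ?_
  rw [vermaBasis_apply, LinearMap.smul_apply, topCoord_vermaMon]
  match m, n with
  | 0, 0 => simp [hwVec_eq_vermaMon]
  | 0, n + 1 => simp [← Q_smul_vermaMon, mem_coinv.1 hψ (vermaMon b' (0, n))]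
  | m + 1, n => simp [← F_smul_vermaMon, mem_coinv.1 hψ (vermaMon b' (m, n))]

theorem coinv_verma_self : coinv b (Verma b 0) = Submodule.span ℂ {topCoord b} := by
  refine le_antisymm (fun ψ hψ => ?_) ((Submodule.span_singleton_le_iff_mem _ _).2 fun y => ?_)
  · exact Submodule.mem_span_singleton.2 ⟨_, (mem_coinv_verma hψ).symm⟩
  · exact ⟨topCoord_F_smul y, topCoord_Q_smul y, topCoord_H_smul y⟩

theorem coinv_verma_of_ne {b' : ℂ} (hb : b ≠ b') : coinv b (Verma b' 0) = ⊥ := by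
  refine (Submodule.eq_bot_iff _).2 fun ψ hψ => ?_
  have h := (hψ (hwVec b' 0)).2.2
  rw [mem_eig.1 hwVec_mem_eig, map_smul, smul_eq_mul, ← sub_eq_zero, ← sub_mul] at h
  rw [mem_coinv_verma hψ, (mul_eq_zero.1 h).resolve_left (sub_ne_zero.2 hb.symm), zero_smul]

instance (b' : ℂ) : FiniteDimensional ℂ (coinv b (Verma b' 0)) := by
  by_cases hb : b = b'
  · subst hb
    rw [coinv_verma_self]
    infer_instance
  · rw [coinv_verma_of_ne hb]
    infer_instance

theorem finrank_coinv_verma_self : Module.finrank ℂ (coinv b (Verma b 0)) = 1 := by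
  rw [coinv_verma_self]
  refine finrank_span_singleton fun h => one_ne_zero (α := ℂ) ?_
  rw [← topCoord_hwVec (a := b), h, LinearMap.zero_apply]

end Coinv

section Flag

variable {M : Type} [AddCommGroup M] [Module U M] [Module ℂ M] [IsScalarTower ℂ U M] {a : ℂ}

open Classical in
theorem finrank_coinv_step (h : TW a M) {A B : Submodule U M} (hAB : A ≤ B) {k : ℕ}
    (e : subQuot A B ≃ₗ[U] Verma (a - k) 0) (j : ℕ) (hA : ∀ c, FiniteDimensional ℂ (eig A c))
    [FiniteDimensional ℂ (coinv (a - j) A)] :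
    (∀ c, FiniteDimensional ℂ (eig B c)) ∧ FiniteDimensional ℂ (coinv (a - j) B) ∧
      Module.finrank ℂ (coinv (a - j) B) = Module.finrank ℂ (coinv (a - j) A) +
        if Nonempty (subQuot A B ≃ₗ[U] Verma (a - j) 0) then 1 else 0 := by
  obtain ⟨g, hg, hgA⟩ := exists_of_subQuot_equiv e
  have hf := Submodule.inclusion_injective hAB
  have hfg (m : B) : g m = 0 ↔ m ∈ LinearMap.range (Submodule.inclusion hAB) := by
    rw [hgA, Submodule.range_inclusion, Submodule.mem_comap, Submodule.subtype_apply]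
  obtain ⟨eq⟩ := coinv_extension (b := a - j) (h.submodule B).top g hg _ hf hfg
  refine ⟨fun c => ?_, Module.Finite.equiv eq.symm, ?_⟩
  · have := hA c
    exact finiteDimensional_eig_of_extension g _ hf hfg
  · rw [eq.finrank_eq, Module.finrank_prod]
    congr 1
    split_ifs with hj
    · rw [eq_of_verma_equiv (e.symm.trans hj.some), finrank_coinv_verma_self]
    · rw [coinv_verma_of_ne, finrank_bot]
      intro hjk
      exact hj ⟨hjk ▸ e⟩

open Classical in
theorem finrank_coinv_flag (h : TW a M) {n : ℕ} {Fl : Fin (n + 1) → Submodule U M}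
    (hmono : Monotone Fl) (h0 : Fl 0 = ⊥)
    (hFl : ∀ k : Fin n, ∃ j : ℕ,
      Nonempty (subQuot (Fl k.castSucc) (Fl k.succ) ≃ₗ[U] Verma (a - j) 0))
    (j k : ℕ) (hk : k < n + 1) :
    (∀ c, FiniteDimensional ℂ (eig (Fl ⟨k, hk⟩) c)) ∧
      FiniteDimensional ℂ (coinv (a - j) (Fl ⟨k, hk⟩)) ∧
      Module.finrank ℂ (coinv (a - j) (Fl ⟨k, hk⟩)) = ∑ l : Fin k,
        if Nonempty (subQuot (Fl ⟨l, by lia⟩) (Fl ⟨l + 1, by lia⟩) ≃ₗ[U] Verma (a - j) 0)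
        then 1 else 0 := by
  induction k with
  | zero =>
    have : Subsingleton (Fl ⟨0, hk⟩) := by
      rw [show Fl ⟨0, hk⟩ = ⊥ from h0]
      infer_instance
    exact ⟨fun c => inferInstance, inferInstance,
      Module.finrank_zero_of_subsingleton.trans (Fin.sum_univ_zero _).symm⟩
  | succ k ih =>
    have hkn : k < n := Nat.succ_lt_succ_iff.1 hk
    obtain ⟨h1, h2, h3⟩ := ih (by lia)
    obtain ⟨l, ⟨e⟩⟩ := hFl ⟨k, hkn⟩
    have : FiniteDimensional ℂ (coinv (a - j) (Fl (Fin.castSucc ⟨k, hkn⟩))) := h2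
    obtain ⟨h4, h5, h6⟩ := finrank_coinv_step h
      (hmono (Fin.castSucc_lt_succ (i := ⟨k, hkn⟩)).le) e j h1
    refine ⟨h4, h5, ?_⟩
    rw [Fin.sum_univ_castSucc]
    exact h6.trans (congrArg (· + _) h3)

theorem finrank_coinv_eq_vermaFlagCount {M : ModuleCat.{0} U} [Module ℂ M] [IsScalarTower ℂ U M]
    (h : TW a M) {n : ℕ} {Fl : Fin (n + 1) → Submodule U (M : Type)} (hFl : IsVermaFlag a n Fl)
    (j : ℕ) :
    (∀ c, FiniteDimensional ℂ (eig M c)) ∧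
      Module.finrank ℂ (coinv (a - j) M) = vermaFlagCount a n Fl j := by
  classical
  obtain ⟨hmono, h0, h1, hq⟩ := hFl
  obtain ⟨h2, -, h3⟩ := finrank_coinv_flag h hmono h0 hq j n (by lia)
  have e : Fl (Fin.last n) ≃ₗ[U] M := (LinearEquiv.ofEq _ _ h1).trans Submodule.topEquiv
  refine ⟨fun c => ?_, ?_⟩
  · have : FiniteDimensional ℂ (eig (Fl (Fin.last n)) c) := h2 c
    let f : eig (Fl (Fin.last n)) c →ₗ[ℂ] eig M c :=
      (e.toLinearMap.restrictScalars ℂ).restrict fun _ hm => map_mem_eig e.toLinearMap hm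
    refine Module.Finite.of_surjective f fun y => ?_
    exact ⟨⟨e.symm y, map_mem_eig e.symm.toLinearMap y.2⟩, Subtype.ext (e.apply_symm_apply _)⟩
  · rw [(coinvEquiv (a - j) e).finrank_eq]
    refine h3.trans ?_
    rw [vermaFlagCount, Nat.card_eq_fintype_card, Fintype.card_subtype, Finset.card_filter]
    rfl

end Flag

section Pairing

variable {M : Type} [AddCommGroup M] [Module U M] [Module ℂ M] [IsScalarTower ℂ U M]
  {a b : ℂ} {i : ℕ}

/-- A functional in `coinv b M` as an element of the twisted dual. -/
def coinvVec (ψ : coinv b M) : Tw M := (ψ : Module.Dual ℂ M)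

theorem coinvVec_apply (ψ : coinv b M) (v : M) :
    coinvVec ψ v = (ψ : Module.Dual ℂ M) v := rfl

/-- A functional in `coinv b M`, seen as a highest weight vector of the twisted dual, defines a
homomorphism from a Verma module. -/
def coinvLift (hM : ∀ v : M, Z • v = 0) (ψ : coinv b M) : Verma b 0 →ₗ[U] Tw M :=
  vermaLift (coinvVec ψ)
    (Tw.ext fun v => by
      rw [Tw.smul_apply, anti_E, neg_smul, coinvVec_apply, map_neg, (ψ.2 v).1, neg_zero,
        Tw.zero_apply])
    (Tw.ext fun v => by
      rw [Tw.smul_apply, anti_P, coinvVec_apply, (ψ.2 v).2.1, Tw.zero_apply])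
    (Tw.mem_eig.2 fun v => (ψ.2 v).2.2)
    (Tw.ext fun v => by
      rw [Tw.smul_apply, anti_Z, hM, coinvVec_apply, map_zero, Tw.zero_apply])

theorem coinvLift_smul_hwVec (hM : ∀ v : M, Z • v = 0) (ψ : coinv b M) (u : U) (v : M) :
    coinvLift hM ψ (u • hwVec b 0) v = (ψ : Module.Dual ℂ M) (anti u • v) := by
  rw [map_smul, Tw.smul_apply, coinvLift, vermaLift_hwVec, coinvVec_apply]

/-- Evaluation of `coinvLift` at a vector. -/
def coinvPairing (hM : ∀ v : M, Z • v = 0) (x : M) (b : ℂ) :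
    coinv b M →ₗ[ℂ] Module.Dual ℂ (Verma b 0) :=
  LinearMap.mk₂ ℂ (fun ψ y => coinvLift hM ψ y x)
    (fun ψ χ y => by
      obtain ⟨u, rfl⟩ := exists_smul_hwVec y
      simp only [coinvLift_smul_hwVec]
      rfl)
    (fun c ψ y => by
      obtain ⟨u, rfl⟩ := exists_smul_hwVec y
      simp only [coinvLift_smul_hwVec]
      rfl)
    (fun ψ y z => by rw [map_add, Tw.add_apply])
    (fun c ψ y => by rw [LinearMap.map_smul_of_tower, Tw.complex_smul_apply, smul_eq_mul])

theorem coinvPairing_apply (hM : ∀ v : M, Z • v = 0) (x : M) (ψ : coinv b M) (y : Verma b 0) :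
    coinvPairing hM x b ψ y = coinvLift hM ψ y x := rfl

theorem finrank_coinv_eq (h : TW a M) {x : M} (hx : x ∈ eig M (a - i))
    (hgen : ∀ y : M, ∃ u : U, u • x = y) {ε : U} (hεx : ε • x = x)
    (hεφ : ∀ (N : Type) [AddCommGroup N] [Module U N] [Module ℂ N]
      [IsScalarTower ℂ U N], TL a N → ∀ m ∈ eig N (a - i), ∃ φ : M →ₗ[U] N, φ x = ε • m)
    (he : MultIdem a i (anti ε)) (j : ℕ) :
    Module.finrank ℂ (coinv (a - j) M) =
      Module.finrank ℂ (fixedPart (a - i) (anti ε) (Verma (a - j) 0)) := by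
  have hV := tw_verma a j
  have hfd : FiniteDimensional ℂ (fixedPart (a - i) (anti ε) (Verma (a - j) 0)) :=
    have := finiteDimensional_eig_verma (a := a - j) (a - i)
    Submodule.finiteDimensional_of_le (S₂ := eig _ (a - i)) fun _ hm => (mem_fixedPart.1 hm).1
  refine Eq.trans ?_ Subspace.dual_finrank_eq
  let T := (fixedPart (a - i) (anti ε) (Verma (a - j) 0)).dualRestrict ∘ₗ
    coinvPairing h.zero x (a - j)
  refine (LinearEquiv.ofBijective T ⟨?_, ?_⟩).finrank_eq
  · refine (injective_iff_map_eq_zero T).2 fun ψ hψ => Subtype.ext (LinearMap.ext fun v => ?_)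
    have h0 (y : Verma (a - j) 0) : coinvPairing h.zero x (a - j) ψ y = 0 := by
      refine (iSup_le fun d y hy => ?_ :
        ⨆ d, eig (Verma (a - j) 0) d ≤ LinearMap.ker (coinvPairing h.zero x (a - j) ψ)) (hV.top y)
      rw [LinearMap.mem_ker, coinvPairing_apply]
      have hm := map_mem_eig (coinvLift h.zero ψ) hy
      by_cases hd : a - i = d
      · subst hd
        have h1 := LinearMap.congr_fun hψ ⟨anti ε • y, he.smul_mem_fixedPart hV hy⟩
        rw [← hεx, ← anti_anti ε, ← Tw.smul_apply, ← map_smul]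
        exact h1
      · exact Tw.apply_eq_zero hm hd hx
    obtain ⟨u, rfl⟩ := hgen v
    have h1 := h0 (anti u • hwVec _ 0)
    rwa [coinvPairing_apply, coinvLift_smul_hwVec, anti_anti] at h1
  · intro χ
    let p : eig (Verma (a - j) 0) (a - i) →ₗ[ℂ] fixedPart (a - i) (anti ε) (Verma (a - j) 0) :=
      (act _ (anti ε)).restrict fun m hm => he.smul_mem_fixedPart hV hm
    obtain ⟨g, hg, hgχ⟩ := exists_weight_functional hV.top (a - i) (χ ∘ₗ p)
    obtain ⟨φ, hφ⟩ := hεφ _ hV.tl_tw g hg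
    let ψ : Module.Dual ℂ M :=
      { toFun := fun v => φ v (hwVec (a - j) 0)
        map_add' := fun v w => by rw [map_add, Tw.add_apply]
        map_smul' := fun c v => by
          rw [LinearMap.map_smul_of_tower, Tw.complex_smul_apply, smul_eq_mul, RingHom.id_apply] }
    have hsmul (u : U) (v : M) : ψ (u • v) = φ v (anti u • hwVec (a - j) 0) := by
      change φ (u • v) _ = _
      rw [map_smul, Tw.smul_apply]
    have hψ : ψ ∈ coinv (a - j) M := by
      refine fun v => ⟨?_, ?_, ?_⟩
      · rw [hsmul, anti_F, neg_smul, E_smul_hwVec, neg_zero]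
        exact map_zero (φ v : Module.Dual ℂ _)
      · rw [hsmul, anti_Q, P_smul_hwVec]
        exact map_zero (φ v : Module.Dual ℂ _)
      · rw [hsmul, anti_H, mem_eig.1 hwVec_mem_eig]
        exact map_smul (φ v : Module.Dual ℂ _) _ _
    refine ⟨⟨ψ, hψ⟩, LinearMap.ext fun m => ?_⟩
    obtain ⟨m, hm⟩ := m
    change coinvLift h.zero ⟨ψ, hψ⟩ m x = _
    have hm' := mem_fixedPart.1 hm
    obtain ⟨u, hu⟩ := exists_smul_hwVec m
    have h1 := coinvLift_smul_hwVec h.zero ⟨ψ, hψ⟩ u x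
    rw [hsmul, anti_anti, hu, hφ, Tw.smul_apply, hm'.2] at h1
    exact h1.trans <| (hgχ ⟨m, hm'.1⟩).trans (congrArg χ (Subtype.ext hm'.2))

end Pairing

/-- Corollary 14 of the paper, BGG reciprocity: let
`ξ ∈ 𝔥*/ℤR` have zero central charge, `λ ∈ ξ` (with `λ(h) = hh0`) and
`i, j ∈ ℤ≥0`.  For any indecomposable projective cover `P^{(λ)}(λ - i·h✓)` of
`L(λ - i·h✓)` in the truncated category `O[ξ, λ]` and any Verma flag of it, the
multiplicity `[P^{(λ)}(λ - i·h✓) : Δ(λ - j·h✓)]` of `Δ(λ - j·h✓)` in the flag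
equals the composition multiplicity `(Δ(λ - j·h✓) : L(λ - i·h✓))`. -/
theorem bgg_reciprocity (hh0 : ℂ) (i j : ℕ)
    (Pm : ModuleCat.{0} U)
    (h1 : InTrunc hh0 Pm) (h2 : ProjInTrunc hh0 Pm) (h3 : Indec Pm)
    (h4 : ∃ π : (Pm : Type) →ₗ[U] SimpleHW (hh0 - i) 0, Function.Surjective π)
    (n : ℕ) (Fl : Fin (n + 1) → Submodule U (Pm : Type))
    (hFl : IsVermaFlag hh0 n Fl) :
    (vermaFlagCount hh0 n Fl j : ℕ∞) =
      compMult (Verma (hh0 - j) 0) (SimpleHW (hh0 - i) 0) := by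
  let _ : Module ℂ Pm := cmod Pm
  have : IsScalarTower ℂ U Pm := isScalarTower_cmod Pm
  have h := TW.of_inTrunc h1
  obtain ⟨hfd, hcount⟩ := finrank_coinv_eq_vermaFlagCount h hFl j
  obtain ⟨π, hπ⟩ := h4
  obtain ⟨x, hx, hπx⟩ := exists_eig_lift h.top π hπ simpleVec_mem_eig
  have hmax (N : Submodule U Pm) (hN : ¬ N ≤ LinearMap.ker π) : N = ⊤ :=
    (tw_simpleHW hh0 i).top_of_not_le_ker h hfd h3.2 h2 π hN
  have hspan : Submodule.span U {x} = ⊤ := hmax _ fun hle => simpleVec_ne_zero <|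
    hπx.symm.trans (hle (Submodule.mem_span_singleton_self x))
  have hgen (y : Pm) : ∃ u : U, u • x = y :=
    Submodule.mem_span_singleton.1 (hspan ▸ Submodule.mem_top)
  obtain ⟨ε, hε, hεx, hεφ⟩ := h.exists_idempotent h2 hx hgen
  have he := multIdem_anti π hπ hπx hmax hε hεx hεφ
  have := finiteDimensional_eig_verma (a := hh0 - j) (hh0 - i)
  rw [he.compMult_eq (tw_verma hh0 j), ← hcount, finrank_coinv_eq h hx hgen hεx hεφ he]

end

end Schrodinger
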